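/- arXiv:1911.05509 — 11 statements merged into one kernel-verified Lean document; each statement's English description precedes it below -/
import Mathlib

section
/- Let A → B be a homomorphism of commutative rings such that both A and B are flat as ℤ-modules (equivalently, torsion-free abelian groups). If for every field k the induced ring homomorphism k ⊗_ℤ A → k ⊗_ℤ B makes k ⊗_ℤ B a flat module over k ⊗_ℤ A, then B is flat as an A-module. -/
open TensorProduct

section

variable {R A : Type*} [CommRing R] [CommRing A] [Algebra R A]
  {M N : Type*} [AddCommGroup M] [AddCommGroup N] [Module A M] [Module A N]
  [Module R M] [Module R N] [IsScalarTower R A M] [IsScalarTower R A N]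

/-- If `C = k ⊗[R] A`, then an `A`-linear map becomes injective after base change to `C` iff it
becomes injective after tensoring with `k` over `R`. -/
lemma Algebra.IsPushout.lTensor_injective_iff (k C : Type*) [CommRing k] [CommRing C]
    [Algebra R k] [Algebra R C] [Algebra k C] [Algebra A C] [IsScalarTower R k C]
    [IsScalarTower R A C] [Algebra.IsPushout R k A C] (f : M →ₗ[A] N) :
    Function.Injective (f.lTensor C) ↔
      Function.Injective ((f.restrictScalars R).lTensor k) := by
  let eM := Algebra.IsPushout.cancelBaseChange R k A C M
  let eN := Algebra.IsPushout.cancelBaseChange R k A C N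
  have key : ∀ x, f.lTensor C (eM.symm x) = eN.symm ((f.restrictScalars R).lTensor k x) := by
    intro x
    induction x with
    | zero => simp
    | add x y hx hy => simp only [map_add, hx, hy]
    | tmul s m => simp [eM, eN]
  have hcomp : f.lTensor C ∘ eM.symm = eN.symm ∘ (f.restrictScalars R).lTensor k := funext key
  rw [← EquivLike.injective_comp eM.symm, hcomp, EquivLike.comp_injective]

/-- If the base change of `B` to `C` is flat over `C`, then tensoring with `B` preserves
the maps that are injective after base change to `C`. -/
lemma LinearMap.lTensor_rTensor_injective_of_flat {C B : Type*} [CommRing C] [Algebra A C]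
    [AddCommGroup B] [Module A B] [Module.Flat C (C ⊗[A] B)] (f : M →ₗ[A] N)
    (hf : Function.Injective (f.lTensor C)) :
    Function.Injective ((f.rTensor B).lTensor C) := by
  let eM := AlgebraTensorModule.distribBaseChange A C M B
  let eN := AlgebraTensorModule.distribBaseChange A C N B
  have hinj : Function.Injective ((f.baseChange C).rTensor (C ⊗[A] B)) :=
    Module.Flat.rTensor_preserves_injective_linearMap _ hf
  have key : ∀ x, eN ((f.rTensor B).baseChange C x) =
      (f.baseChange C).rTensor (C ⊗[A] B) (eM x) := by
    intro x
    induction x with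
    | zero => simp
    | add x y hx hy => simp only [map_add, hx, hy]
    | tmul s m =>
      induction m with
      | zero => simp
      | add x y hx hy => simp only [map_add, tmul_add, hx, hy]
      | tmul m b => simp [eM, eN]
  have hcomp : eN ∘ (f.rTensor B).baseChange C =
      (f.baseChange C).rTensor (C ⊗[A] B) ∘ eM := funext key
  change Function.Injective ((f.rTensor B).baseChange C)
  rw [← EquivLike.comp_injective _ eN, hcomp]
  exact hinj.comp eM.injective

/-- An element of `M` that vanishes in `k ⊗[R] M`, where `k = R / (p)`, is a multiple of `p`. -/
lemma exists_eq_smul_of_one_tmul_eq_zero {k : Type*} [CommRing k] [Algebra R k] {p : R}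
    (hk : Function.Surjective (algebraMap R k))
    (hp : RingHom.ker (algebraMap R k) = Ideal.span {p}) {x : M}
    (hx : (1 : k) ⊗ₜ[R] x = 0) : ∃ y, x = p • y := by
  have hex : Function.Exact (LinearMap.toSpanSingleton R R p) (Algebra.linearMap R k) := by
    intro y
    rw [Algebra.linearMap_apply, ← RingHom.mem_ker, hp, Ideal.mem_span_singleton']
    simp
  have h := rTensor_exact M hex hk ((1 : R) ⊗ₜ[R] x)
  obtain ⟨y, hy⟩ := h.1 (by simpa using hx)
  refine ⟨TensorProduct.lid R M y, ?_⟩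
  have hxy := congrArg (TensorProduct.lid R M) hy
  rw [lid_tmul, one_smul] at hxy
  rw [← hxy]
  clear hy hxy
  induction y with
  | zero => simp
  | add x y hx hy => simp only [map_add, smul_add, hx, hy]
  | tmul s m => simp [mul_comm s p, mul_smul]

end

attribute [local instance] Algebra.TensorProduct.rightAlgebra

/-- Let `0 → K → F → M → 0` be a short exact sequence of `A`-modules with `M` and `F ⊗[A] B` flat
over `R`. If the fiber of `B` over `k = R / (p)` is flat over the fiber of `A`, then
multiplication by `p` is injective on `M ⊗[A] B`. -/
lemma isSMulRegular_tensorProduct_of_exact {R A B k K F M : Type*} [CommRing R] [CommRing A]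
    [CommRing B] [Algebra R A] [Algebra A B] [CommRing k] [Algebra R k]
    [AddCommGroup K] [Module A K] [Module R K] [IsScalarTower R A K]
    [AddCommGroup F] [Module A F] [Module R F] [IsScalarTower R A F]
    [AddCommGroup M] [Module A M] [Module R M] [IsScalarTower R A M]
    [Module.Flat R M] [Module.Flat R (F ⊗[A] B)]
    [Module.Flat (k ⊗[R] A) ((k ⊗[R] A) ⊗[A] B)] {p : R}
    (hreg : IsRegular p) (hk : Function.Surjective (algebraMap R k))
    (hp : RingHom.ker (algebraMap R k) = Ideal.span {p}) {ι : K →ₗ[A] F} {π : F →ₗ[A] M}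
    (hι : Function.Injective ι) (hιπ : Function.Exact ι π) (hπ : Function.Surjective π) :
    IsSMulRegular (M ⊗[A] B) p := by
  have hιk : Function.Injective ((ι.restrictScalars R).lTensor k) :=
    LinearMap.lTensor_injective_of_exact_of_flat (π.restrictScalars R) hπ
      (ι.restrictScalars R) hι hιπ k
  have hιB : Function.Injective (((ι.rTensor B).restrictScalars R).lTensor k) :=
    (Algebra.IsPushout.lTensor_injective_iff (R := R) k (k ⊗[R] A) _).1
      (LinearMap.lTensor_rTensor_injective_of_flat ι
        ((Algebra.IsPushout.lTensor_injective_iff (R := R) k (k ⊗[R] A) _).2 hιk))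
  have hF : IsSMulRegular (F ⊗[A] B) p := Module.Flat.isSMulRegular_of_isRegular hreg
  have hex := rTensor_exact B hιπ hπ
  refine (isSMulRegular_iff_right_eq_zero_of_smul).2 fun x hx ↦ ?_
  obtain ⟨y, rfl⟩ := LinearMap.rTensor_surjective B hπ x
  have hpy : π.rTensor B (p • y) = 0 :=
    (((π.rTensor B).restrictScalars R).map_smul p y).trans hx
  obtain ⟨z, hz⟩ := (hex _).1 hpy
  have hz0 : (1 : k) ⊗ₜ[R] z = 0 := by
    apply hιB
    have hp0 : algebraMap R k p = 0 := by
      rw [← RingHom.mem_ker, hp]; exact Ideal.mem_span_singleton_self p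
    rw [map_zero, LinearMap.lTensor_tmul, LinearMap.restrictScalars_apply, hz, tmul_smul,
      smul_tmul', Algebra.smul_def, hp0, zero_mul, zero_tmul]
  obtain ⟨w, rfl⟩ := exists_eq_smul_of_one_tmul_eq_zero hk hp hz0
  refine (hex _).2 ⟨w, hF ?_⟩
  exact (((ι.rTensor B).restrictScalars R).map_smul p w).symm.trans hz

/-- If `B` is flat over `R` and its fiber over `k = R / (p)` is flat over the fiber of `A`, then
multiplication by `p` remains injective on `M ⊗[A] B` for every `R`-flat `A`-module `M`. -/
lemma isSMulRegular_tensorProduct_of_flat_fiber {R A B : Type*} (k : Type*) {M : Type*}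
    [CommRing R] [CommRing A] [CommRing B] [Algebra R A] [Algebra R B] [Algebra A B]
    [IsScalarTower R A B] [CommRing k] [Algebra R k]
    [AddCommGroup M] [Module A M] [Module R M] [IsScalarTower R A M]
    [Module.Flat R B] [Module.Flat R M] [Module.Flat (k ⊗[R] A) ((k ⊗[R] A) ⊗[A] B)] {p : R}
    (hreg : IsRegular p) (hk : Function.Surjective (algebraMap R k))
    (hp : RingHom.ker (algebraMap R k) = Ideal.span {p}) :
    IsSMulRegular (M ⊗[A] B) p := by
  classical
  have : Module.Flat R ((M →₀ A) ⊗[A] B) :=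
    .of_linearEquiv ((finsuppScalarLeft A B M).restrictScalars R ≪≫ₗ
      finsuppLEquivDirectSum R B M)
  exact isSMulRegular_tensorProduct_of_exact (k := k) (π := Finsupp.linearCombination A id)
    hreg hk hp (Submodule.injective_subtype _) (LinearMap.exact_subtype_ker_map _)
    (Finsupp.linearCombination_id_surjective A M)

/-- Over a principal ideal domain `R`, flatness of a morphism of flat `R`-algebras can be tested
on the fibers over all fields. -/
theorem Module.Flat.of_flat_fibers_of_isPrincipalIdealRing.{u} {R : Type u} {A B : Type*} [CommRing R]
    [IsDomain R] [IsPrincipalIdealRing R] [CommRing A] [CommRing B] [Algebra R A] [Algebra R B]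
    [Algebra A B] [IsScalarTower R A B] [Module.Flat R A] [Module.Flat R B]
    (h : ∀ (k : Type u) [Field k] [Algebra R k],
      Module.Flat (k ⊗[R] A) ((k ⊗[R] A) ⊗[A] B)) : Module.Flat A B := by
  refine Module.Flat.iff_rTensor_injective'.2 fun I ↦ ?_
  have hI : Module.Flat R I := by
    have : Module.IsTorsionFree R I :=
      Function.Injective.moduleIsTorsionFree _ (Submodule.injective_subtype I) fun _ _ ↦ rfl
    infer_instance
  have hreg (r : R) (hr : r ≠ 0) : IsSMulRegular (I ⊗[A] B) r := by
    induction r using UniqueFactorizationMonoid.induction_on_prime with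
    | h₁ => exact absurd rfl hr
    | h₂ u hu => exact hu.isSMulRegular _
    | h₃ a p ha hp ih =>
      have : (Ideal.span {p}).IsMaximal := PrincipalIdealRing.isMaximal_of_irreducible hp.irreducible
      let := Ideal.Quotient.field (Ideal.span {p})
      have := h (R ⧸ Ideal.span {p})
      exact (isSMulRegular_tensorProduct_of_flat_fiber (R ⧸ Ideal.span {p})
        (IsRegular.of_ne_zero hp.ne_zero) Ideal.Quotient.mk_surjective Ideal.mk_ker).mul (ih ha)
  have hIB : Module.Flat R (I ⊗[A] B) := by
    have : Module.IsTorsionFree R (I ⊗[A] B) := ⟨fun r hr ↦ hreg r hr.ne_zero⟩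
    infer_instance
  let K := FractionRing R
  have := h K
  have := IsLocalization.flat K (nonZeroDivisors R)
  have hK : Function.Injective (((I.subtype.rTensor B).restrictScalars R).lTensor K) :=
    (Algebra.IsPushout.lTensor_injective_iff (R := R) K (K ⊗[R] A) _).1
      (LinearMap.lTensor_rTensor_injective_of_flat _
        ((Algebra.IsPushout.lTensor_injective_iff (R := R) K (K ⊗[R] A) _).2
          (Module.Flat.lTensor_preserves_injective_linearMap _ (Submodule.injective_subtype I))))
  have hincl : Function.Injective fun x : I ⊗[A] B ↦ (1 : K) ⊗ₜ[R] x := by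
    have := Module.Flat.rTensor_preserves_injective_linearMap (M := I ⊗[A] B)
      (Algebra.linearMap R K) (IsFractionRing.injective R K)
    convert! this.comp (TensorProduct.lid R (I ⊗[A] B)).symm.injective using 1
    ext x
    simp
  intro x y hxy
  refine hincl (hK ?_)
  simp [hxy]

/-- If `k ⊗[R] A → k ⊗[R] B` is flat, then so is the base change of `A → B` to `k ⊗[R] A`. -/
lemma flat_tensorProduct_of_flat_map {R k A B : Type*} [CommRing R] [CommRing k] [CommRing A]
    [CommRing B] [Algebra R k] [Algebra R A] [Algebra R B] [Algebra A B] [IsScalarTower R A B]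
    (h : letI : Algebra (k ⊗[R] A) (k ⊗[R] B) := (Algebra.TensorProduct.map (AlgHom.id R k)
        (IsScalarTower.toAlgHom R A B)).toRingHom.toAlgebra
      Module.Flat (k ⊗[R] A) (k ⊗[R] B)) :
    Module.Flat (k ⊗[R] A) ((k ⊗[R] A) ⊗[A] B) := by
  let : Algebra (k ⊗[R] A) (k ⊗[R] B) := (Algebra.TensorProduct.map (AlgHom.id R k)
    (IsScalarTower.toAlgHom R A B)).toRingHom.toAlgebra
  let : Algebra A (k ⊗[R] B) := ((algebraMap B (k ⊗[R] B)).comp (algebraMap A B)).toAlgebra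
  have : IsScalarTower A B (k ⊗[R] B) := .of_algebraMap_eq' rfl
  have : IsScalarTower A (k ⊗[R] A) (k ⊗[R] B) := .of_algebraMap_eq fun a ↦ by
    change (1 : k) ⊗ₜ[R] algebraMap A B a = Algebra.TensorProduct.map (AlgHom.id R k)
      (IsScalarTower.toAlgHom R A B) (1 ⊗ₜ a)
    simp
  have : IsScalarTower k (k ⊗[R] A) (k ⊗[R] B) := .of_algebraMap_eq fun a ↦ by
    change a ⊗ₜ[R] (1 : B) = Algebra.TensorProduct.map (AlgHom.id R k)
      (IsScalarTower.toAlgHom R A B) (a ⊗ₜ 1)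
    simp
  have : IsScalarTower R (k ⊗[R] A) (k ⊗[R] B) := .of_algebraMap_eq fun r ↦ by
    rw [IsScalarTower.algebraMap_apply R k (k ⊗[R] A),
      ← IsScalarTower.algebraMap_apply k (k ⊗[R] A), ← IsScalarTower.algebraMap_apply R k]
  have hpush : Algebra.IsPushout A B (k ⊗[R] A) (k ⊗[R] B) :=
    (Algebra.IsPushout.comp_iff R A k (k ⊗[R] A)).1 inferInstance
  have := hpush.symm
  exact .of_linearEquiv (Algebra.IsPushout.equiv A (k ⊗[R] A) B (k ⊗[R] B)).toLinearEquiv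

/-- **Flatness can be tested on fibers over fields** (Lemma 3.2 of the paper).
If `A → B` is a morphism of commutative rings, both flat over `ℤ`, such that for every
field `k` the induced map `k ⊗[ℤ] A → k ⊗[ℤ] B` is flat, then `B` is flat over `A`. -/
theorem flat_of_flat_fibers (A B : Type) [CommRing A] [CommRing B] (f : A →+* B)
    [Module.Flat ℤ A] [Module.Flat ℤ B]
    (h : ∀ (k : Type) [Field k],
      letI : Algebra (k ⊗[ℤ] A) (k ⊗[ℤ] B) :=
        ((Algebra.TensorProduct.map (AlgHom.id ℤ k) f.toIntAlgHom).toRingHom).toAlgebra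
      Module.Flat (k ⊗[ℤ] A) (k ⊗[ℤ] B)) :
    letI : Algebra A B := f.toAlgebra
    Module.Flat A B := by
  let : Algebra A B := f.toAlgebra
  refine Module.Flat.of_flat_fibers_of_isPrincipalIdealRing (R := ℤ) fun k _ inst ↦ ?_
  obtain rfl : inst = Ring.toIntAlgebra k := Subsingleton.elim _ _
  exact flat_tensorProduct_of_flat_map (h k)
end

section
/- Let A → B be a homomorphism of commutative rings such that both A and B are flat as ℤ-modules (equivalently, torsion-free abelian groups). If for every field k the induced ring homomorphism k ⊗_ℤ A → k ⊗_ℤ B makes k ⊗_ℤ B a faithfully flat module over k ⊗_ℤ A, then B is faithfully flat as an A-module. -/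
open TensorProduct

section

variable {R A B : Type*} [CommRing R] [CommRing A] [CommRing B] [Algebra R A] [Algebra R B]
  [Algebra A B] [IsScalarTower R A B] (k : Type*) [CommRing k] [Algebra R k]
  {M N : Type*} [AddCommGroup M] [AddCommGroup N] [Module A M] [Module A N]

/-- If `D` is flat over an `A`-algebra `C`, then an `A`-linear map which becomes injective over `C`
remains injective over `D`. -/
theorem LinearMap.lTensor_injective_of_flat_of_tower {C D : Type*} [CommRing C] [CommRing D]
    [Algebra A C] [Algebra C D] [Algebra A D] [IsScalarTower A C D] [Module.Flat C D]
    (g : M →ₗ[A] N) (hg : Function.Injective (g.lTensor C)) :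
    Function.Injective (g.lTensor D) := by
  have h := Module.Flat.lTensor_preserves_injective_linearMap (M := D) (g.baseChange C) hg
  have comm (x) := LinearMap.congr_fun
    (AlgebraTensorModule.lTensor_comp_cancelBaseChange (R := A) (A := C) (B := C) (M := D) g) x
  let e := AlgebraTensorModule.cancelBaseChange A C C D M
  refine (EquivLike.injective_comp e _).mp fun x y hxy ↦ h ?_
  exact (AlgebraTensorModule.cancelBaseChange A C C D N).injective
    ((comm x).symm.trans (hxy.trans (comm y)))

variable [Module R M] [Module R N] [IsScalarTower R A M] [IsScalarTower R A N]

/-- If `k ⊗ B` is flat over `k ⊗ A`, then an `A`-linear map `g` which becomes injective after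
tensoring with `k` over `R` still does so after tensoring it first with `B` over `A`. -/
theorem LinearMap.rTensor_rTensor_injective_of_flat
    (hk : (Algebra.TensorProduct.map (AlgHom.id R k) (IsScalarTower.toAlgHom R A B)).toRingHom.Flat)
    (g : M →ₗ[A] N) (hg : Function.Injective ((g.restrictScalars R).rTensor k)) :
    Function.Injective (((g.rTensor B).restrictScalars R).rTensor k) := by
  let φ : A ⊗[R] k →ₐ[R] B ⊗[R] k :=
    Algebra.TensorProduct.map (IsScalarTower.toAlgHom R A B) (AlgHom.id R k)
  have hφ : φ.toRingHom.Flat := by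
    have key : φ = ((Algebra.TensorProduct.comm R k B).toAlgHom.comp
        (Algebra.TensorProduct.map (AlgHom.id R k) (IsScalarTower.toAlgHom R A B))).comp
        (Algebra.TensorProduct.comm R A k).toAlgHom := by
      ext <;> simp [φ]
    rw [key]
    exact (RingHom.Flat.of_bijective (Algebra.TensorProduct.comm R A k).bijective).comp
      (hk.comp (RingHom.Flat.of_bijective (Algebra.TensorProduct.comm R k B).bijective))
  let : Algebra (A ⊗[R] k) (B ⊗[R] k) := φ.toRingHom.toAlgebra
  have : Module.Flat (A ⊗[R] k) (B ⊗[R] k) := hφ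
  have : IsScalarTower A (A ⊗[R] k) (B ⊗[R] k) := .of_algebraMap_eq fun a ↦ by
    simp [RingHom.algebraMap_toAlgebra, φ, Algebra.TensorProduct.algebraMap_apply]
  have hA : Function.Injective (g.rTensor (A ⊗[R] k)) := by
    have comm (x) : AlgebraTensorModule.cancelBaseChange R A A N k (g.rTensor (A ⊗[R] k) x) =
        (g.restrictScalars R).rTensor k (AlgebraTensorModule.cancelBaseChange R A A M k x) := by
      induction x with
      | zero => simp
      | add x y hx hy => simp only [map_add, hx, hy]
      | tmul m c =>
        induction c with
        | zero => simp
        | add x y hx hy => simp only [map_add, tmul_add, hx, hy]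
        | tmul a c => simp
    intro x y hxy
    exact (AlgebraTensorModule.cancelBaseChange R A A M k).injective
      (hg (by rw [← comm, ← comm, hxy]))
  have hB : Function.Injective (g.rTensor (B ⊗[R] k)) := by
    rw [← LinearMap.lTensor_inj_iff_rTensor_inj] at hA ⊢
    exact LinearMap.lTensor_injective_of_flat_of_tower g hA
  have comm (x) : AlgebraTensorModule.assoc R A A N B k
      (((g.rTensor B).restrictScalars R).rTensor k x) =
      g.rTensor (B ⊗[R] k) (AlgebraTensorModule.assoc R A A M B k x) := by
    induction x with
    | zero => simp
    | add x y hx hy => simp only [map_add, hx, hy]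
    | tmul m c =>
      induction m with
      | zero => simp
      | add x y hx hy => simp only [map_add, add_tmul, hx, hy]
      | tmul a c => simp
  intro x y hxy
  exact (AlgebraTensorModule.assoc R A A M B k).injective (hB (by rw [← comm, ← comm, hxy]))

/-- If `k ⊗ B` is faithfully flat over `k ⊗ A`, then the fiber of `B` over any homomorphism
`q : A → k` is nontrivial. -/
theorem Ideal.map_ker_ne_top_of_faithfullyFlat [Nontrivial k] (q : A →ₐ[R] k)
    (hk : (Algebra.TensorProduct.map (AlgHom.id R k)
      (IsScalarTower.toAlgHom R A B)).toRingHom.FaithfullyFlat) :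
    (RingHom.ker q).map (algebraMap A B) ≠ ⊤ := by
  let φ := Algebra.TensorProduct.map (AlgHom.id R k) (IsScalarTower.toAlgHom R A B)
  let : Algebra (k ⊗[R] A) (k ⊗[R] B) := φ.toRingHom.toAlgebra
  have : Module.FaithfullyFlat (k ⊗[R] A) (k ⊗[R] B) := hk
  let ψ : k ⊗[R] A →ₐ[R] k := Algebra.TensorProduct.productMap (AlgHom.id R k) q
  intro htop
  refine RingHom.ker_ne_top ψ ?_
  rw [← Ideal.comap_map_eq_self_of_faithfullyFlat (B := k ⊗[R] B) (RingHom.ker ψ),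
    Ideal.comap_eq_top_iff, ← top_le_iff,
    ← Ideal.map_top (Algebra.TensorProduct.includeRight : B →ₐ[R] k ⊗[R] B), ← htop,
    Ideal.map_le_iff_le_comap, Ideal.map_le_iff_le_comap]
  intro a ha
  have hmem : (1 : k) ⊗ₜ[R] a ∈ RingHom.ker ψ := by simpa [ψ, RingHom.mem_ker] using ha
  simpa [RingHom.algebraMap_toAlgebra, φ] using
    Ideal.mem_map_of_mem (algebraMap (k ⊗[R] A) (k ⊗[R] B)) hmem

end

section

variable {T : Type*} [AddCommGroup T] {n : ℕ}

theorem ZMod.exists_eq_tmul_one (x : T ⊗[ℤ] ZMod n) : ∃ t : T, x = t ⊗ₜ 1 := by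
  induction x with
  | zero => exact ⟨0, by simp⟩
  | add x y hx hy =>
    obtain ⟨a, rfl⟩ := hx
    obtain ⟨b, rfl⟩ := hy
    exact ⟨a + b, (add_tmul ..).symm⟩
  | tmul t c =>
    obtain ⟨c, rfl⟩ := ZMod.intCast_surjective c
    exact ⟨c • t, by rw [smul_tmul, zsmul_one]⟩

theorem ZMod.tmul_one_eq_zero_iff {t : T} :
    t ⊗ₜ[ℤ] (1 : ZMod n) = 0 ↔ ∃ s : T, (n : ℤ) • s = t := by
  constructor
  · intro h
    have ex : Function.Exact ((n : ℤ) • LinearMap.id : ℤ →ₗ[ℤ] ℤ)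
        (Int.castAddHom (ZMod n)).toIntLinearMap := fun c ↦ by
      simp [ZMod.intCast_zmod_eq_zero_iff_dvd, dvd_def, eq_comm]
    obtain ⟨y, hy⟩ := (lTensor_exact T ex ZMod.intCast_surjective (t ⊗ₜ 1)).mp (by simpa using h)
    rw [LinearMap.lTensor_smul, LinearMap.lTensor_id] at hy
    refine ⟨TensorProduct.rid ℤ T y, ?_⟩
    simpa using congrArg (TensorProduct.rid ℤ T) hy
  · rintro ⟨s, rfl⟩
    simp [smul_tmul]

end

section

variable {A B : Type*} [CommRing A] [CommRing B] [Algebra A B]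

theorem Module.Flat.int_tensorProduct_of_free [Module.Flat ℤ B] (F : Type*) [AddCommGroup F]
    [Module A F] [Module.Free A F] : Module.Flat ℤ (F ⊗[A] B) := by
  have : Module.Flat ℤ (B ⊗[A] F) := Module.Flat.trans ℤ B _
  exact Module.Flat.of_linearEquiv ((TensorProduct.comm A F B).toAddEquiv.toIntLinearEquiv)

/-- If `B/n` is flat over `A/n` and `0 → L → F → K → 0` is an exact sequence of `A`-modules such
that `n` is regular on `K` and on `F ⊗ B`, then `n` is regular on `K ⊗ B`. -/
theorem IsSMulRegular.tensorProduct_of_exact {n : ℕ}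
    (hk : (Algebra.TensorProduct.map (AlgHom.id ℤ (ZMod n))
      (IsScalarTower.toAlgHom ℤ A B)).toRingHom.Flat)
    {L F K : Type*} [AddCommGroup L] [AddCommGroup F] [AddCommGroup K]
    [Module A L] [Module A F] [Module A K] {g : L →ₗ[A] F} {π : F →ₗ[A] K}
    (hinj : Function.Injective g) (hex : Function.Exact g π) (hπ : Function.Surjective π)
    (hF : IsSMulRegular (F ⊗[A] B) (n : ℤ)) (hK : IsSMulRegular K (n : ℤ)) :
    IsSMulRegular (K ⊗[A] B) (n : ℤ) := by
  have ex : Function.Exact (g.rTensor B) (π.rTensor B) := rTensor_exact B hex hπ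
  have hg : Function.Injective ((g.restrictScalars ℤ).rTensor (ZMod n)) := by
    rw [injective_iff_map_eq_zero]
    intro x hx
    obtain ⟨r, rfl⟩ := ZMod.exists_eq_tmul_one x
    obtain ⟨y, hy⟩ := ZMod.tmul_one_eq_zero_iff.mp hx
    have hy0 : π y = 0 := hK.right_eq_zero_of_smul (by
      rw [← map_zsmul, hy]
      exact hex.apply_apply_eq_zero r)
    obtain ⟨w, rfl⟩ := (hex y).mp hy0
    exact ZMod.tmul_one_eq_zero_iff.mpr ⟨w, hinj ((map_zsmul g _ _).trans hy)⟩
  have hgB := LinearMap.rTensor_rTensor_injective_of_flat (ZMod n) hk g hg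
  refine isSMulRegular_iff_right_eq_zero_of_smul.mpr fun x hx ↦ ?_
  obtain ⟨y, rfl⟩ := LinearMap.rTensor_surjective B hπ x
  obtain ⟨z, hz⟩ := (ex ((n : ℤ) • y)).mp (by rw [map_zsmul, hx])
  obtain ⟨w, rfl⟩ := ZMod.tmul_one_eq_zero_iff.mp ((injective_iff_map_eq_zero _).mp hgB (z ⊗ₜ 1)
    (ZMod.tmul_one_eq_zero_iff.mpr ⟨y, hz.symm⟩))
  rw [map_zsmul] at hz
  rw [← hF hz]
  exact ex.apply_apply_eq_zero w

/-- If `B` is `ℤ`-flat and `B/n` is flat over `A/n`, then tensoring with `B` over `A` preserves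
regularity of `n`. -/
theorem IsSMulRegular.tensorProduct_of_flat_zmod [Module.Flat ℤ B] {n : ℕ} (hn : n ≠ 0)
    (hk : (Algebra.TensorProduct.map (AlgHom.id ℤ (ZMod n))
      (IsScalarTower.toAlgHom ℤ A B)).toRingHom.Flat)
    {K : Type*} [AddCommGroup K] [Module A K] (hK : IsSMulRegular K (n : ℤ)) :
    IsSMulRegular (K ⊗[A] B) (n : ℤ) := by
  let π : (K →₀ A) →ₗ[A] K := Finsupp.linearCombination A id
  have : Module.Flat ℤ ((K →₀ A) ⊗[A] B) := Module.Flat.int_tensorProduct_of_free _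
  exact .tensorProduct_of_exact (L := π.ker) (F := K →₀ A) hk π.ker.injective_subtype π.exact_subtype_ker_map
    (Finsupp.linearCombination_id_surjective A K)
    (Module.IsTorsionFree.isSMulRegular (.of_ne_zero (by exact_mod_cast hn))) hK

theorem Module.isTorsionFree_int_of_prime {T : Type*} [AddCommGroup T]
    (h : ∀ p : ℕ, p.Prime → IsSMulRegular T (p : ℤ)) : Module.IsTorsionFree ℤ T := by
  have hn (n : ℕ) : n ≠ 0 → IsSMulRegular T (n : ℤ) := by
    induction n using induction_on_primes with
    | zero => simp
    | one => simp
    | prime_mul p a hp ha =>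
      intro hpa
      rw [Nat.cast_mul]
      exact (h p hp).mul (ha (right_ne_zero_of_mul hpa))
  refine Module.isTorsionFree_iff_smul_eq_zero.mpr fun r t hrt ↦ ?_
  refine or_iff_not_imp_left.mpr fun hr ↦
    (hn r.natAbs (Int.natAbs_ne_zero.mpr hr)).right_eq_zero_of_smul ?_
  rcases Int.natAbs_eq r with h | h <;> rw [h] at hrt <;> simpa using hrt

/-- A ring map between `ℤ`-flat rings is flat if its fibers over all prime fields are. -/
theorem Module.Flat.of_flat_prime_fibers [Module.Flat ℤ A] [Module.Flat ℤ B]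
    (hp : ∀ p : ℕ, p.Prime → (Algebra.TensorProduct.map (AlgHom.id ℤ (ZMod p))
      (IsScalarTower.toAlgHom ℤ A B)).toRingHom.Flat)
    (hQ : (Algebra.TensorProduct.map (AlgHom.id ℤ ℚ)
      (IsScalarTower.toAlgHom ℤ A B)).toRingHom.Flat) :
    Module.Flat A B := by
  refine Module.Flat.iff_rTensor_injective'.mpr fun I ↦ ?_
  have hI : Module.IsTorsionFree ℤ I :=
    Function.Injective.moduleIsTorsionFree I.subtype I.injective_subtype fun _ _ ↦ rfl
  have : Module.IsTorsionFree ℤ (I ⊗[A] B) := Module.isTorsionFree_int_of_prime fun p h ↦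
    IsSMulRegular.tensorProduct_of_flat_zmod h.ne_zero (hp p h)
      (hI.isSMulRegular (.of_ne_zero (by exact_mod_cast h.ne_zero)))
  have hIB := LinearMap.rTensor_rTensor_injective_of_flat ℚ hQ I.subtype
    (Module.Flat.rTensor_preserves_injective_linearMap _ I.injective_subtype)
  have hℚ : Function.Injective fun x : I ⊗[A] B ↦ x ⊗ₜ[ℤ] (1 : ℚ) :=
    (Module.Flat.lTensor_preserves_injective_linearMap (M := I ⊗[A] B) (Algebra.linearMap ℤ ℚ)
      Int.cast_injective).comp (TensorProduct.rid ℤ (I ⊗[A] B)).symm.injective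
  exact fun x y hxy ↦ hℚ (hIB (congrArg (· ⊗ₜ[ℤ] (1 : ℚ)) hxy))

end

/-- **Flatness can be tested on fibers over fields** (Lemma 3.2 of the paper).
If `A → B` is a morphism of commutative rings, both flat over `ℤ`, such that for every
field `k` the induced map `k ⊗[ℤ] A → k ⊗[ℤ] B` is faithfully flat, then `B` is faithfully flat over `A`. -/
theorem faithfullyFlat_of_faithfullyFlat_fibers (A B : Type) [CommRing A] [CommRing B] (f : A →+* B)
    [Module.Flat ℤ A] [Module.Flat ℤ B]
    (h : ∀ (k : Type) [Field k],
      letI : Algebra (k ⊗[ℤ] A) (k ⊗[ℤ] B) :=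
        ((Algebra.TensorProduct.map (AlgHom.id ℤ k) f.toIntAlgHom).toRingHom).toAlgebra
      Module.FaithfullyFlat (k ⊗[ℤ] A) (k ⊗[ℤ] B)) :
    letI : Algebra A B := f.toAlgebra
    Module.FaithfullyFlat A B := by
  let : Algebra A B := f.toAlgebra
  have hk (k : Type) [Field k] : (Algebra.TensorProduct.map (AlgHom.id ℤ k)
      (IsScalarTower.toAlgHom ℤ A B)).toRingHom.FaithfullyFlat := h k
  have : Module.Flat A B := .of_flat_prime_fibers
    (fun p hp ↦ have := Fact.mk hp; (hk (ZMod p)).flat) (hk ℚ).flat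
  refine ⟨fun m hm hmB ↦ ?_⟩
  let := Ideal.Quotient.field m
  refine Ideal.map_ker_ne_top_of_faithfullyFlat (A ⧸ m) (Ideal.Quotient.mk m).toIntAlgHom
    (hk (A ⧸ m)) ?_
  have hker : RingHom.ker (Ideal.Quotient.mk m).toIntAlgHom = m := Ideal.mk_ker
  rw [Ideal.smul_top_eq_map] at hmB
  simpa [hker] using hmB
end

section
/- Let R be a commutative ring which is a binomial ring, i.e. R is ℤ-torsion-free (multiplication by every positive integer is injective) and for every r ∈ R and every k ≥ 1 the element r(r−1)⋯(r−k+1) is divisible by k! in R. Then for every r ∈ R there exists a unique ring homomorphism φ : B → R with φ(X) = r. -/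
/-- The ring `B` of integer-valued polynomials: the subring of `ℚ[X]` consisting of
polynomials `P` with `P(n) ∈ ℤ` for all `n ∈ ℤ`. -/
noncomputable def intValuedPoly : Subring (Polynomial ℚ) where
  carrier := {P | ∀ n : ℤ, ∃ m : ℤ, P.eval (n : ℚ) = (m : ℚ)}
  zero_mem' := fun n => ⟨0, by simp⟩
  one_mem' := fun n => ⟨1, by simp⟩
  add_mem' := by
    intro P Q hP hQ n
    obtain ⟨a, ha⟩ := hP n
    obtain ⟨b, hb⟩ := hQ n
    exact ⟨a + b, by simp [ha, hb]⟩
  mul_mem' := by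
    intro P Q hP hQ n
    obtain ⟨a, ha⟩ := hP n
    obtain ⟨b, hb⟩ := hQ n
    exact ⟨a * b, by simp [ha, hb]⟩
  neg_mem' := by
    intro P hP n
    obtain ⟨a, ha⟩ := hP n
    exact ⟨-a, by simp [ha]⟩

lemma X_mem_intValuedPoly : (Polynomial.X : Polynomial ℚ) ∈ intValuedPoly :=
  fun n => ⟨n, by simp⟩

open Polynomial Finset in
/-- Newton's forward difference formula for polynomials over a field of characteristic zero. -/
lemma Polynomial.eq_sum_fwdDiff_iter_smul_descPochhammer {K : Type*} [Field K] [CharZero K]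
    (P : K[X]) :
    P = ∑ k ∈ range (P.natDegree + 1),
      C ((fwdDiff 1)^[k] (fun x => P.eval x) 0 / (k.factorial : K)) * descPochhammer K k := by
  refine Polynomial.eq_of_infinite_eval_eq _ _ (Set.Infinite.mono ?_
    ((Set.Ici_infinite P.natDegree).image (Nat.cast_injective (R := K)).injOn))
  rintro _ ⟨m, hm, rfl⟩
  have h := shift_eq_sum_fwdDiff_iter (1 : K) (fun x => P.eval x) m 0
  simp only [zero_add, nsmul_eq_mul, mul_one] at h
  rw [Set.mem_ofPred_eq, h, eval_finsetSum]
  symm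
  refine (sum_congr rfl fun k _ => ?_).trans
    (sum_subset (range_mono (Nat.succ_le_succ hm)) fun k _ hk => ?_)
  · rw [Nat.cast_choose_eq_descPochhammer_div, eval_mul, eval_C]
    ring
  · have hk' : P.natDegree < k := by simpa using hk
    have := congrFun (Polynomial.fwdDiff_iter_eq_zero_of_degree_lt hk') 0
    rw [this]
    simp

open Finset in
lemma exists_intCast_eq_fwdDiff_iter_eval {P : Polynomial ℚ} (hP : P ∈ intValuedPoly) (k : ℕ) :
    ∃ c : ℤ, (c : ℚ) = (fwdDiff 1)^[k] (fun x => P.eval x) 0 := by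
  choose v hv using hP
  refine ⟨∑ i ∈ range (k + 1), (-1) ^ (k - i) * (k.choose i : ℤ) * v i, ?_⟩
  rw [fwdDiff_iter_eq_sum_shift]
  push_cast
  refine sum_congr rfl fun i _ => ?_
  have := hv i
  push_cast at this
  simp [this]

/-- `s` is a value of the rational polynomial `P` at `r`: clearing denominators in `P` by some
positive integer `N` gives an integral polynomial whose value at `r` is `N * s`. -/
def IsRatPolyValue {R : Type*} [CommRing R] (r : R) (P : Polynomial ℚ) (s : R) : Prop :=
  ∃ N : ℕ, 0 < N ∧ ∃ Q : Polynomial ℤ,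
    (N : Polynomial ℚ) * P = Q.map (Int.castRingHom ℚ) ∧ (N : R) * s = Polynomial.aeval r Q

namespace IsRatPolyValue

variable {R : Type*} [CommRing R] {r s t : R} {P P' : Polynomial ℚ}

lemma of_map_intCast (Q : Polynomial ℤ) :
    IsRatPolyValue r (Q.map (Int.castRingHom ℚ)) (Polynomial.aeval r Q) :=
  ⟨1, one_pos, Q, by simp, by simp⟩

lemma add (h : IsRatPolyValue r P s) (h' : IsRatPolyValue r P' t) :
    IsRatPolyValue r (P + P') (s + t) := by
  obtain ⟨N, hN, Q, hQ, hs⟩ := h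
  obtain ⟨N', hN', Q', hQ', ht⟩ := h'
  refine ⟨N * N', Nat.mul_pos hN hN', N' * Q + N * Q', ?_, ?_⟩
  · simp only [Polynomial.map_add, Polynomial.map_mul, Polynomial.map_natCast, ← hQ, ← hQ']
    push_cast
    ring
  · simp only [map_add, map_mul, map_natCast, ← hs, ← ht]
    push_cast
    ring

lemma mul (h : IsRatPolyValue r P s) (h' : IsRatPolyValue r P' t) :
    IsRatPolyValue r (P * P') (s * t) := by
  obtain ⟨N, hN, Q, hQ, hs⟩ := h
  obtain ⟨N', hN', Q', hQ', ht⟩ := h'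
  refine ⟨N * N', Nat.mul_pos hN hN', Q * Q', ?_, ?_⟩
  · simp only [Polynomial.map_mul, ← hQ, ← hQ']
    push_cast
    ring
  · simp only [map_mul, ← hs, ← ht]
    push_cast
    ring

lemma unique (htf : ∀ n : ℕ, 0 < n → Function.Injective (fun r : R => (n : R) * r))
    (h : IsRatPolyValue r P s) (h' : IsRatPolyValue r P t) : s = t := by
  obtain ⟨N, hN, Q, hQ, hs⟩ := h
  obtain ⟨N', hN', Q', hQ', ht⟩ := h'
  have hQQ' : (N' : Polynomial ℤ) * Q = N * Q' := by
    apply Polynomial.map_injective (Int.castRingHom ℚ) Int.cast_injective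
    simp only [Polynomial.map_mul, Polynomial.map_natCast, ← hQ, ← hQ']
    ring
  have hr := congrArg (Polynomial.aeval r) hQQ'
  simp only [map_mul, map_natCast, ← hs, ← ht] at hr
  apply htf _ (Nat.mul_pos hN hN')
  push_cast
  linear_combination hr

lemma exists_sum {ι : Type*} (S : Finset ι) (f : ι → Polynomial ℚ)
    (h : ∀ i ∈ S, ∃ s, IsRatPolyValue r (f i) s) : ∃ s, IsRatPolyValue r (∑ i ∈ S, f i) s :=
  Finset.sum_induction f (fun P => ∃ s, IsRatPolyValue r P s)
    (fun _ _ ⟨s, hs⟩ ⟨t, ht⟩ => ⟨s + t, hs.add ht⟩) ⟨0, by simpa using of_map_intCast (r := r) 0⟩ h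

lemma exists_of_mem_intValuedPoly
    (hdiv : ∀ k : ℕ, 1 ≤ k →
      ∃ s : R, (Nat.factorial k : R) * s = ∏ i ∈ Finset.range k, (r - (i : R)))
    (hP : P ∈ intValuedPoly) : ∃ s, IsRatPolyValue r P s := by
  rw [P.eq_sum_fwdDiff_iter_smul_descPochhammer]
  refine exists_sum _ _ fun k _ => ?_
  obtain ⟨c, hc⟩ := exists_intCast_eq_fwdDiff_iter_eval hP k
  obtain ⟨s, hs⟩ : ∃ s : R, (Nat.factorial k : R) * s = ∏ i ∈ Finset.range k, (r - (i : R)) := by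
    rcases k.eq_zero_or_pos with rfl | hk
    · exact ⟨1, by simp⟩
    · exact hdiv k hk
  refine ⟨c * s, k.factorial, k.factorial_pos, c * descPochhammer ℤ k, ?_, ?_⟩
  · have hk : (k.factorial : ℚ) ≠ 0 := by exact_mod_cast k.factorial_ne_zero
    rw [← hc, Polynomial.map_mul, descPochhammer_map, Polynomial.map_intCast, ← mul_assoc,
      ← Polynomial.C_eq_natCast, ← Polynomial.C_mul, mul_div_cancel₀ _ hk, map_intCast]
  · rw [map_mul, map_intCast, Polynomial.aeval_def, Polynomial.eval₂_eq_eval_map,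
      descPochhammer_map, descPochhammer_eval_eq_prod_range, ← hs]
    ring

lemma of_ringHom (φ : intValuedPoly →+* R) (hφ : φ ⟨Polynomial.X, X_mem_intValuedPoly⟩ = r)
    (hP : ∃ s, IsRatPolyValue r P s) (hmem : P ∈ intValuedPoly) :
    IsRatPolyValue r P (φ ⟨P, hmem⟩) := by
  obtain ⟨_, N, hN, Q, hQ, -⟩ := hP
  refine ⟨N, hN, Q, hQ, ?_⟩
  have hB : (N : intValuedPoly) * ⟨P, hmem⟩ =
      Polynomial.aeval (⟨Polynomial.X, X_mem_intValuedPoly⟩ : intValuedPoly) Q := by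
    apply Subtype.ext
    have h := Polynomial.hom_eval₂ Q (algebraMap ℤ intValuedPoly) intValuedPoly.subtype
      ⟨Polynomial.X, X_mem_intValuedPoly⟩
    rw [Polynomial.aeval_def, ← intValuedPoly.subtype_apply (Polynomial.eval₂ _ _ _), h]
    push_cast
    rw [hQ, Polynomial.map, RingHom.ext_int (intValuedPoly.subtype.comp _)
      (Polynomial.C.comp (Int.castRingHom ℚ))]
    rfl
  rw [← map_natCast φ, ← map_mul, hB, Polynomial.aeval_def, Polynomial.hom_eval₂, hφ,
    Polynomial.aeval_def, RingHom.ext_int (φ.comp _) (algebraMap ℤ R)]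

end IsRatPolyValue

/-- `B` is the free binomial ring on one generator: for every binomial ring `R`
(ℤ-torsion-free, with `r(r-1)⋯(r-k+1)` divisible by `k!` for all `r` and `k ≥ 1`)
and every `r ∈ R`, there is a unique ring homomorphism `φ : B → R` with `φ(X) = r`. -/
theorem intValuedPoly_free_binomial (R : Type) [CommRing R]
    (htf : ∀ n : ℕ, 0 < n → Function.Injective (fun r : R => (n : R) * r))
    (hdiv : ∀ (r : R) (k : ℕ), 1 ≤ k →
      ∃ s : R, (Nat.factorial k : R) * s = ∏ i ∈ Finset.range k, (r - (i : R)))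
    (r : R) :
    ∃! φ : intValuedPoly →+* R, φ ⟨Polynomial.X, X_mem_intValuedPoly⟩ = r := by
  choose v hv using fun P : intValuedPoly =>
    IsRatPolyValue.exists_of_mem_intValuedPoly (hdiv r) P.2
  have eq_v {P : intValuedPoly} {s : R} (h : IsRatPolyValue r (P : Polynomial ℚ) s) : v P = s :=
    (hv P).unique htf h
  refine ⟨
    { toFun := v
      map_one' := eq_v (by simpa using IsRatPolyValue.of_map_intCast (r := r) 1)
      map_zero' := eq_v (by simpa using IsRatPolyValue.of_map_intCast (r := r) 0)
      map_add' := fun P Q => eq_v ((hv P).add (hv Q))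
      map_mul' := fun P Q => eq_v ((hv P).mul (hv Q)) },
    eq_v (by simpa using IsRatPolyValue.of_map_intCast (r := r) Polynomial.X), fun φ hφ => ?_⟩
  ext P
  exact (eq_v (IsRatPolyValue.of_ringHom φ hφ ⟨_, hv P⟩ P.2)).symm
end

section
/- Let R be a commutative ring which is a ℚ-algebra. Then the map sending a ring homomorphism φ : B → R to the element φ(X) ∈ R is a bijection from the set of ring homomorphisms B → R onto R. -/
/-- Every integer-valued polynomial has a nonzero integer multiple that is an integral
polynomial expression in `X`. -/
lemma exists_intCast_mul_eq_aeval_X (P : intValuedPoly) :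
    ∃ d : ℤ, d ≠ 0 ∧ ∃ Q : Polynomial ℤ,
      (d : intValuedPoly) * P =
        Polynomial.aeval (⟨Polynomial.X, X_mem_intValuedPoly⟩ : intValuedPoly) Q := by
  obtain ⟨d, hd, h⟩ :=
    IsLocalization.integerNormalization_spec (nonZeroDivisors ℤ) (P : Polynomial ℚ)
  refine ⟨d, nonZeroDivisors.ne_zero hd,
    IsLocalization.integerNormalization (nonZeroDivisors ℤ) (P : Polynomial ℚ), ?_⟩
  apply Subtype.ext
  have hX := Polynomial.aeval_algHom_apply intValuedPoly.subtype.toIntAlgHom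
    (⟨Polynomial.X, X_mem_intValuedPoly⟩ : intValuedPoly)
    (IsLocalization.integerNormalization (nonZeroDivisors ℤ) (P : Polynomial ℚ))
  calc (((d : intValuedPoly) * P : intValuedPoly) : Polynomial ℚ)
      = d • (P : Polynomial ℚ) := by simp
    _ = _ := h.symm
    _ = Polynomial.aeval (Polynomial.X : Polynomial ℚ) _ :=
      (Polynomial.aeval_X_left_eq_map _).symm
    _ = _ := hX

/-- For a `ℚ`-algebra `R`, evaluation at the generator `X` is a bijection from the set
of ring homomorphisms `B → R` onto `R`: the Hilbert group scheme `ℍ = Spec B` becomes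
the additive group `𝔾ₐ` over `ℚ`. -/
theorem intValuedPoly_homs_equiv_of_charZero (R : Type) [CommRing R] [Algebra ℚ R] :
    Function.Bijective
      (fun φ : intValuedPoly →+* R => φ ⟨Polynomial.X, X_mem_intValuedPoly⟩) := by
  constructor
  · intro φ ψ h
    ext P
    obtain ⟨d, hd, Q, hQ⟩ := exists_intCast_mul_eq_aeval_X P
    have key (χ : intValuedPoly →+* R) : (d : R) * χ P =
        Polynomial.aeval (χ ⟨Polynomial.X, X_mem_intValuedPoly⟩) Q := by
      rw [← map_intCast χ d, ← map_mul, hQ]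
      exact (Polynomial.aeval_algHom_apply χ.toIntAlgHom _ Q).symm
    have hu : IsUnit (d : R) := by
      rw [← map_intCast (algebraMap ℚ R) d]
      exact (IsUnit.mk0 (d : ℚ) (Int.cast_ne_zero.mpr hd)).map _
    apply hu.mul_left_cancel
    rw [key, key]
    exact congrArg (fun x => Polynomial.aeval x Q) h
  · intro r
    exact ⟨(Polynomial.aeval r : Polynomial ℚ →ₐ[ℚ] R).toRingHom.comp intValuedPoly.subtype,
      Polynomial.aeval_X r⟩
end

section
/- The map sending a ring homomorphism φ : B → ℤ to the integer φ(X) is a bijection from the set of ring homomorphisms B → ℤ onto ℤ; equivalently, every ring homomorphism B → ℤ is given by evaluation P ↦ P(a) at a unique integer a. -/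
/-- Evaluation of integer-valued polynomials at an integer, as a ring homomorphism to `ℤ`. -/
noncomputable def intValuedPolyEval (a : ℤ) : intValuedPoly →+* ℤ :=
  (RingEquiv.ofBijective (Int.castRingHom ℚ).rangeRestrict
    ⟨fun _ _ h => Int.cast_injective (congrArg Subtype.val h),
      RingHom.rangeRestrict_surjective _⟩).symm.toRingHom.comp
    (((Polynomial.evalRingHom (a : ℚ)).comp intValuedPoly.subtype).codRestrict
      (Int.castRingHom ℚ).range fun P => (P.2 a).imp fun _ h => h.symm)

lemma intValuedPolyEval_cast (a : ℤ) (P : intValuedPoly) :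
    (intValuedPolyEval a P : ℚ) = (P : Polynomial ℚ).eval (a : ℚ) :=
  congrArg Subtype.val (RingEquiv.apply_symm_apply
    (RingEquiv.ofBijective (Int.castRingHom ℚ).rangeRestrict
      ⟨fun _ _ h => Int.cast_injective (congrArg Subtype.val h),
        RingHom.rangeRestrict_surjective _⟩) _)

/-- Every ring homomorphism from integer-valued polynomials to `ℤ` is evaluation at the image
of `X`. -/
lemma intValuedPoly_hom_cast (φ : intValuedPoly →+* ℤ) (P : intValuedPoly) :
    (φ P : ℚ) = (P : Polynomial ℚ).eval (φ ⟨Polynomial.X, X_mem_intValuedPoly⟩ : ℚ) := by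
  obtain ⟨d, hdM, hd⟩ := IsLocalization.integerNormalization_spec
    (nonZeroDivisors ℤ) (P : Polynomial ℚ)
  set Q := IsLocalization.integerNormalization (nonZeroDivisors ℤ) (P : Polynomial ℚ)
  have hd0 : (d : ℚ) ≠ 0 := Int.cast_ne_zero.mpr (nonZeroDivisors.ne_zero hdM)
  have hQ : Polynomial.aeval (⟨Polynomial.X, X_mem_intValuedPoly⟩ : intValuedPoly) Q
      = d • P := by
    apply Subtype.ext
    have h := Polynomial.hom_eval₂ Q (algebraMap ℤ intValuedPoly) intValuedPoly.subtype
      ⟨Polynomial.X, X_mem_intValuedPoly⟩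
    have h' : Polynomial.eval₂ (intValuedPoly.subtype.comp (algebraMap ℤ intValuedPoly))
        Polynomial.X Q = Q.map (algebraMap ℤ ℚ) := by
      rw [Polynomial.map, RingHom.ext_int (intValuedPoly.subtype.comp _)
        (Polynomial.C.comp (algebraMap ℤ ℚ))]
    exact h.trans (h'.trans hd)
  have hφ : Q.eval (φ ⟨Polynomial.X, X_mem_intValuedPoly⟩) = d * φ P := by
    have h := congrArg φ hQ
    rw [Polynomial.aeval_def, Polynomial.hom_eval₂, map_zsmul, smul_eq_mul] at h
    rwa [RingHom.ext_int (φ.comp _) (RingHom.id ℤ)] at h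
  have he := congrArg (Polynomial.eval (φ ⟨Polynomial.X, X_mem_intValuedPoly⟩ : ℚ)) hd
  rw [algebraMap_int_eq, Polynomial.eval_intCast_map, Int.cast_id, hφ] at he
  apply mul_left_cancel₀ hd0
  simpa [zsmul_eq_mul] using he

/-- Evaluation at the generator `X` is a bijection from the set of ring homomorphisms
`B → ℤ` onto `ℤ`: every ring homomorphism `B → ℤ` is evaluation at a unique integer,
i.e. `ℤ ≅ ℍ(ℤ)`. -/
theorem intValuedPoly_homs_to_int_equiv :
    Function.Bijective
      (fun φ : intValuedPoly →+* ℤ => φ ⟨Polynomial.X, X_mem_intValuedPoly⟩) := by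
  refine ⟨fun φ ψ h => RingHom.ext fun P => ?_, fun a => ⟨intValuedPolyEval a, ?_⟩⟩
  · have h' : φ ⟨Polynomial.X, X_mem_intValuedPoly⟩ = ψ ⟨Polynomial.X, X_mem_intValuedPoly⟩ := h
    apply Int.cast_injective (α := ℚ)
    rw [intValuedPoly_hom_cast φ, intValuedPoly_hom_cast ψ, h']
  · apply Int.cast_injective (α := ℚ)
    simp [intValuedPolyEval_cast]
end

section
/- Fix a prime p and an integer n ≥ 1. For a ∈ ℤ_p let ev_a : B → ℤ/p^n be the map P ↦ (P̂(a) mod p^n), where P̂ : ℤ_p → ℤ_p is the unique continuous extension of the function m ↦ P(m) on ℤ. Then each ev_a is a ring homomorphism, and the map a ↦ ev_a is a bijection from ℤ_p onto the set of ring homomorphisms B → ℤ/p^n. -/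
lemma exists_intCast_eq_eval (P : intValuedPoly) (k : ℤ) :
    ∃ m : ℤ, (P : Polynomial ℚ).eval (k : ℚ) = (m : ℚ) :=
  P.2 k

lemma norm_aeval_padicInt_le_one (p : ℕ) [Fact p.Prime] (P : intValuedPoly) (a : ℤ_[p]) :
    ‖Polynomial.aeval (a : ℚ_[p]) (P : Polynomial ℚ)‖ ≤ 1 := by
  refine PadicInt.denseRange_intCast.induction_on
    (p := fun a : ℤ_[p] => ‖Polynomial.aeval (a : ℚ_[p]) (P : Polynomial ℚ)‖ ≤ 1) a ?_ ?_
  · exact isClosed_le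
      (((P : Polynomial ℚ).continuous_aeval.comp continuous_subtype_val).norm) continuous_const
  · intro k
    obtain ⟨m, hm⟩ := exists_intCast_eq_eval P k
    have h := Polynomial.aeval_algebraMap_apply ℚ_[p] (k : ℚ) (P : Polynomial ℚ)
    rw [Polynomial.coe_aeval_eq_eval, hm] at h
    simp only [map_intCast] at h
    rw [PadicInt.coe_intCast, h]
    exact Padic.norm_int_le_one m

/-- Evaluation of integer-valued polynomials at a `p`-adic integer. -/
noncomputable def padicEval (p : ℕ) [Fact p.Prime] (a : ℤ_[p]) : intValuedPoly →+* ℤ_[p] :=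
  RingHom.codRestrict
    ((Polynomial.aeval (R := ℚ) (a : ℚ_[p])).toRingHom.comp intValuedPoly.subtype)
    (PadicInt.subring p) fun P => norm_aeval_padicInt_le_one p P a

lemma coe_padicEval (p : ℕ) [Fact p.Prime] (a : ℤ_[p]) (P : intValuedPoly) :
    (padicEval p a P : ℚ_[p]) = Polynomial.aeval (a : ℚ_[p]) (P : Polynomial ℚ) :=
  rfl

lemma padicEval_X (p : ℕ) [Fact p.Prime] (a : ℤ_[p]) :
    padicEval p a ⟨Polynomial.X, X_mem_intValuedPoly⟩ = a := by
  apply Subtype.ext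
  rw [coe_padicEval]
  simp

lemma padicEval_intCast (p : ℕ) [Fact p.Prime] (P : intValuedPoly) {k m : ℤ}
    (h : (P : Polynomial ℚ).eval (k : ℚ) = (m : ℚ)) :
    padicEval p (k : ℤ_[p]) P = (m : ℤ_[p]) := by
  apply Subtype.ext
  rw [coe_padicEval]
  have h' := Polynomial.aeval_algebraMap_apply ℚ_[p] (k : ℚ) (P : Polynomial ℚ)
  rw [Polynomial.coe_aeval_eq_eval, h] at h'
  simpa using h'

lemma continuous_padicEval (p : ℕ) [Fact p.Prime] (P : intValuedPoly) :
    Continuous fun a : ℤ_[p] => padicEval p a P :=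
  Continuous.subtype_mk ((P : Polynomial ℚ).continuous_aeval.comp continuous_subtype_val) _

lemma eq_padicEval_of_continuous (p : ℕ) [Fact p.Prime] (P : intValuedPoly) {f : ℤ_[p] → ℤ_[p]}
    (hf : Continuous f)
    (h : ∀ k m : ℤ, (P : Polynomial ℚ).eval (k : ℚ) = (m : ℚ) → f (k : ℤ_[p]) = (m : ℤ_[p])) :
    f = fun a => padicEval p a P := by
  refine PadicInt.denseRange_intCast.equalizer hf (continuous_padicEval p P) ?_
  funext k
  obtain ⟨m, hm⟩ := exists_intCast_eq_eval P k
  exact (h k m hm).trans (padicEval_intCast p P hm).symm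

lemma natCast_dvd_of_forall_dvd_eval {d : ℕ} (hd : d ≠ 0) (P : intValuedPoly)
    (h : ∀ k m : ℤ, (P : Polynomial ℚ).eval (k : ℚ) = (m : ℚ) → (d : ℤ) ∣ m) :
    (d : intValuedPoly) ∣ P := by
  have hd' : (d : ℚ) ≠ 0 := Nat.cast_ne_zero.mpr hd
  refine ⟨⟨Polynomial.C (d : ℚ)⁻¹ * (P : Polynomial ℚ), fun k => ?_⟩, ?_⟩
  · obtain ⟨m, hm⟩ := exists_intCast_eq_eval P k
    obtain ⟨c, rfl⟩ := h k m hm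
    refine ⟨c, ?_⟩
    rw [Polynomial.eval_mul, Polynomial.eval_C, hm]
    push_cast
    field_simp
  · apply Subtype.ext
    change (P : Polynomial ℚ) = ((d : intValuedPoly) : Polynomial ℚ) * _
    rw [← mul_assoc, Subring.coe_natCast, ← Polynomial.C_eq_natCast, ← Polynomial.C_mul,
      mul_inv_cancel₀ hd', Polynomial.C_1, one_mul]

lemma natCast_dvd_pow_sub_self (p : ℕ) [Fact p.Prime] (P : intValuedPoly) :
    (p : intValuedPoly) ∣ P ^ p - P := by
  refine natCast_dvd_of_forall_dvd_eval (Fact.out : p.Prime).ne_zero _ fun k m hm => ?_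
  obtain ⟨c, hc⟩ := exists_intCast_eq_eval P k
  have : m = c ^ p - c := by
    have h : (m : ℚ) = (c : ℚ) ^ p - c := by
      rw [← hm, ← hc]
      simp
    exact_mod_cast h
  rw [this, ← ZMod.intCast_zmod_eq_zero_iff_dvd]
  simp [ZMod.pow_card]

lemma pow_succ_dvd_pow_sub_pow {A : Type*} [CommRing A] {p k : ℕ} (hk : k ≠ 0) {a b : A}
    (h : (p : A) ^ k ∣ a - b) : (p : A) ^ (k + 1) ∣ a ^ p - b ^ p := by
  rw [← geom_sum₂_mul, pow_succ']
  refine mul_dvd_mul ?_ h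
  rw [dvd_geom_sum₂_iff_of_dvd_sub ((dvd_pow_self _ hk).trans h)]
  exact dvd_mul_right _ _

/-- Two ring homomorphisms out of the ring of integer-valued polynomials which agree modulo `p`
agree modulo every power of `p`. -/
lemma pow_dvd_sub_of_dvd_sub {A : Type*} [CommRing A] (p : ℕ) [Fact p.Prime]
    {f g : intValuedPoly →+* A} (h : ∀ P, (p : A) ∣ f P - g P) (k : ℕ) (P : intValuedPoly) :
    (p : A) ^ (k + 1) ∣ f P - g P := by
  induction k generalizing P with
  | zero => simpa using h P
  | succ k ih =>
    obtain ⟨R, hR⟩ := natCast_dvd_pow_sub_self p P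
    have hf := congrArg f hR
    have hg := congrArg g hR
    simp only [map_sub, map_pow, map_mul, map_natCast] at hf hg
    have key : f P - g P = (f P ^ p - g P ^ p) - p * (f R - g R) := by
      linear_combination hg - hf
    rw [key]
    refine dvd_sub (pow_succ_dvd_pow_sub_pow k.succ_ne_zero (ih P)) ?_
    rw [pow_succ']
    exact mul_dvd_mul_left _ (ih R)

lemma eq_of_dvd_padicEval_sub (p : ℕ) [Fact p.Prime] {a b : ℤ_[p]}
    (h : ∀ P, (p : ℤ_[p]) ∣ padicEval p a P - padicEval p b P) : a = b := by
  rw [← PadicInt.ext_of_toZModPow]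
  intro k
  have hk := pow_dvd_sub_of_dvd_sub p h k ⟨Polynomial.X, X_mem_intValuedPoly⟩
  rw [padicEval_X, padicEval_X] at hk
  rw [← sub_eq_zero, ← map_sub, ← RingHom.mem_ker, PadicInt.ker_toZModPow,
    Ideal.mem_span_singleton]
  exact (pow_dvd_pow _ k.le_succ).trans hk

/-- A ring homomorphism from the integer-valued polynomials to a nontrivial ring where `p` is
nilpotent, taking integer values `c P`, is modulo `p` an evaluation at some `p`-adic integer. -/
lemma exists_padicEval_dvd_sub {A : Type*} [CommRing A] [Nontrivial A] (p : ℕ) [Fact p.Prime]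
    (hA : IsNilpotent (p : A)) (φ : intValuedPoly →+* A) (c : intValuedPoly → ℤ)
    (hc : ∀ P, φ P = (c P : A)) :
    ∃ a : ℤ_[p], ∀ P, (p : ℤ_[p]) ∣ padicEval p a P - (c P : ℤ_[p]) := by
  have hclosed : ∀ P, IsClosed {a : ℤ_[p] | ‖padicEval p a P - (c P : ℤ_[p])‖ < 1} := by
    intro P
    have h := (IsUltrametricDist.isClosed_ball (0 : ℤ_[p]) 1).preimage
      ((continuous_padicEval p P).sub (continuous_const (y := (c P : ℤ_[p]))))
    simpa [Set.preimage, Metric.ball] using h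
  have hfin : ∀ u : Finset intValuedPoly,
      (⋂ P ∈ u, {a : ℤ_[p] | ‖padicEval p a P - (c P : ℤ_[p])‖ < 1}).Nonempty := by
    intro u
    by_contra hempty
    have hp : p - 1 ≠ 0 := Nat.sub_ne_zero_of_lt (Fact.out : p.Prime).one_lt
    have hdvd : (p : intValuedPoly) ∣ ∏ P ∈ u, (1 - (P - (c P : intValuedPoly)) ^ (p - 1)) := by
      refine natCast_dvd_of_forall_dvd_eval (Fact.out : p.Prime).ne_zero _ fun k m hm => ?_
      choose v hv using fun P : intValuedPoly => exists_intCast_eq_eval P k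
      have hm' : m = ∏ P ∈ u, (1 - (v P - c P) ^ (p - 1)) := by
        have h : (m : ℚ) = ∏ P ∈ u, (1 - ((v P : ℚ) - c P) ^ (p - 1)) := by
          rw [← hm]
          simp [Polynomial.eval_prod, hv]
        exact_mod_cast h
      have hex : ∃ P ∈ u, ¬ (p : ℤ) ∣ v P - c P := by
        by_contra! hall
        refine hempty ⟨(k : ℤ_[p]), ?_⟩
        simp only [Set.mem_iInter, Set.mem_ofPred_eq]
        intro P hP
        rw [padicEval_intCast p P (hv P), ← Int.cast_sub, PadicInt.norm_int_lt_one_iff_dvd]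
        exact hall P hP
      obtain ⟨P, hP, hnd⟩ := hex
      rw [hm']
      refine dvd_trans ?_ (Finset.dvd_prod_of_mem _ hP)
      rw [← ZMod.intCast_zmod_eq_zero_iff_dvd] at hnd ⊢
      rw [Int.cast_sub, Int.cast_pow, ZMod.pow_card_sub_one_eq_one hnd]
      simp
    obtain ⟨G, hG⟩ := hdvd
    have h1 := congrArg φ hG
    have hz : ∀ P, φ P - (c P : A) = 0 := fun P => sub_eq_zero.mpr (hc P)
    have h2 : (1 : A) = p * φ G := by simpa [hz, hp] using h1
    obtain ⟨N, hN⟩ := hA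
    have h3 := congrArg (· ^ N) h2
    simp [mul_pow, hN] at h3
  obtain ⟨a, ha⟩ := CompactSpace.iInter_nonempty hclosed hfin
  refine ⟨a, fun P => ?_⟩
  rw [← PadicInt.norm_lt_one_iff_dvd]
  exact Set.mem_iInter.mp ha P

/-- Point-level content of Corollary 2.3: for a prime `p` and `n ≥ 1`, the map
`a ↦ ev_a`, where `ev_a(P) = P̂(a) mod p^n` and `P̂ : ℤ_p → ℤ_p` is the unique continuous
extension of `m ↦ P(m)`, is a bijection from `ℤ_p` onto the set of ring homomorphisms
`B → ℤ/p^n`; in particular each `ev_a` is a ring homomorphism. -/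
theorem intValuedPoly_homs_to_zmod_equiv_padicInt (p : ℕ) [Fact p.Prime]
    (n : ℕ) (hn : 1 ≤ n) :
    ∃ e : ℤ_[p] ≃ (intValuedPoly →+* ZMod (p ^ n)),
      ∀ (a : ℤ_[p]) (P : intValuedPoly) (f : ℤ_[p] → ℤ_[p]),
        Continuous f →
        (∀ (k m : ℤ), (P : Polynomial ℚ).eval (k : ℚ) = (m : ℚ) → f (k : ℤ_[p]) = (m : ℤ_[p])) →
        e a P = PadicInt.toZModPow n (f a) := by
  have hn0 : n ≠ 0 := Nat.one_le_iff_ne_zero.mp hn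
  have hp : p.Prime := Fact.out
  have : Fact (1 < p ^ n) := ⟨Nat.one_lt_pow hn0 hp.one_lt⟩
  have hpn : (p : ZMod (p ^ n)) ^ n = 0 := by
    rw [← Nat.cast_pow, ZMod.natCast_self]
  have hbij : Function.Bijective fun a : ℤ_[p] =>
      (PadicInt.toZModPow n).comp (padicEval p a) := by
    constructor
    · intro a b hab
      refine eq_of_dvd_padicEval_sub p fun P => ?_
      have h := RingHom.congr_fun hab P
      simp only [RingHom.comp_apply] at h
      rw [← sub_eq_zero, ← map_sub, ← RingHom.mem_ker, PadicInt.ker_toZModPow,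
        Ideal.mem_span_singleton] at h
      exact (dvd_pow_self _ hn0).trans h
    · intro φ
      obtain ⟨a, ha⟩ := exists_padicEval_dvd_sub p ⟨n, hpn⟩ φ
        (fun P => ((φ P).val : ℤ)) (fun P => by simp)
      refine ⟨a, RingHom.ext fun P => ?_⟩
      have hdvd : ∀ Q, (p : ZMod (p ^ n)) ∣
          (PadicInt.toZModPow n).comp (padicEval p a) Q - φ Q := fun Q => by
        simpa using map_dvd (PadicInt.toZModPow n) (ha Q)
      have h := (pow_dvd_pow _ n.le_succ).trans (pow_dvd_sub_of_dvd_sub p hdvd n P)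
      rwa [hpn, zero_dvd_iff, sub_eq_zero] at h
  refine ⟨Equiv.ofBijective _ hbij, fun a P f hf h => ?_⟩
  rw [eq_padicEval_of_continuous p P hf h]
  rfl
end

section
/- Let p be a prime and K a field of characteristic p. The fixed subring { x ∈ 𝕎(K) : frobenius(x) = x } of the Frobenius endomorphism of the ring of p-typical Witt vectors of K is isomorphic, as a ring, to the ring ℤ_p of p-adic integers. -/
/-- In a field of characteristic `p`, every element fixed by `x ↦ x ^ p` comes from `ZMod p`. -/
theorem exists_zmod_cast_eq_of_pow_eq_self (p : ℕ) [Fact p.Prime] (K : Type*) [Field K]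
    [CharP K p] {a : K} (ha : a ^ p = a) : ∃ c : ZMod p, ZMod.castHom dvd_rfl K c = a := by
  rwa [← Subfield.mem_bot_iff_pow_eq_self K p, ← ZMod.fieldRange_castHom_eq_bot p] at ha

/-- For a field `K` of characteristic `p`, the fixed subring of the Frobenius
endomorphism of the ring of `p`-typical Witt vectors `𝕎(K)` is isomorphic, as a ring,
to the ring `ℤ_p` of `p`-adic integers. -/
theorem wittVector_frobenius_fixed_subring_iso_padicInt (p : ℕ) [Fact p.Prime]
    (K : Type) [Field K] [CharP K p] :
    Nonempty
      ((RingHom.eqLocus (WittVector.frobenius : WittVector p K →+* WittVector p K)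
        (RingHom.id (WittVector p K))) ≃+* ℤ_[p]) := by
  let φ : WittVector p (ZMod p) →+* WittVector p K := WittVector.map (ZMod.castHom dvd_rfl K)
  have hφ : Function.Injective φ := WittVector.map_injective _ (RingHom.injective _)
  have hrange : φ.range = RingHom.eqLocus
      (WittVector.frobenius : WittVector p K →+* WittVector p K)
      (RingHom.id (WittVector p K)) := by
    ext x
    simp only [RingHom.mem_range, RingHom.mem_eqLocus, RingHom.id_apply]
    constructor
    · rintro ⟨y, rfl⟩
      ext n
      rw [WittVector.coeff_frobenius_charP, WittVector.map_coeff, ← map_pow, ZMod.pow_card]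
    · intro hx
      have hcoeff (n : ℕ) : ∃ c : ZMod p, ZMod.castHom dvd_rfl K c = x.coeff n :=
        exists_zmod_cast_eq_of_pow_eq_self p K <| by
          rw [← WittVector.coeff_frobenius_charP, hx]
      choose c hc using hcoeff
      refine ⟨WittVector.mk p c, ?_⟩
      ext n
      rw [WittVector.map_coeff, WittVector.coeff_mk, hc]
  rw [← hrange]
  exact ⟨(RingEquiv.ofBijective φ.rangeRestrict
    ⟨fun _ _ h => hφ (congrArg Subtype.val h), φ.rangeRestrict_surjective⟩).symm.trans
      (WittVector.equiv p)⟩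
end

section
/- Let p be a prime and K an algebraically closed field of characteristic p. Then the map 𝕎(K) → 𝕎(K), x ↦ frobenius(x) − x, is surjective: for every y ∈ 𝕎(K) there exists x ∈ 𝕎(K) with frobenius(x) − x = y. -/
open Polynomial in
theorem IsAlgClosed.exists_pow_sub_self_eq {K : Type*} [Field K] [IsAlgClosed K] {n : ℕ}
    (hn : 1 < n) (a : K) : ∃ c : K, c ^ n - c = a := by
  have hdeg : (X ^ n - X - C a : K[X]).natDegree = n := by
    rw [natDegree_sub_C, natDegree_sub_eq_left_of_natDegree_lt] <;> simp [hn]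
  obtain ⟨c, hc⟩ := IsAlgClosed.exists_root (X ^ n - X - C a : K[X])
    (degree_ne_of_natDegree_ne (hdeg.trans_ne (Nat.ne_zero_of_lt hn)))
  exact ⟨c, by simpa [IsRoot, sub_eq_zero] using hc⟩

/-- Artin–Schreier–Witt surjectivity: for an algebraically closed field `K` of
characteristic `p`, the map `x ↦ frobenius x - x` on `p`-typical Witt vectors `𝕎(K)`
is surjective. -/
theorem wittVector_frobenius_sub_id_surjective (p : ℕ) [Fact p.Prime]
    (K : Type) [Field K] [IsAlgClosed K] [CharP K p] :
    ∀ y : WittVector p K, ∃ x : WittVector p K,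
      WittVector.frobenius x - x = y := by
  let I : Ideal ℤ := Ideal.span {(p : ℤ)}
  have hI : I.map (algebraMap ℤ (WittVector p K)) = Ideal.span {(p : WittVector p K)} := by
    simp [I, Ideal.map_span]
  have hcomplete : IsAdicComplete (I.map (algebraMap ℤ (WittVector p K))) (WittVector p K) :=
    hI ▸ WittVector.isAdicCompleteIdealSpanP
  have : IsHausdorff I (WittVector p K) :=
    IsHausdorff.map_algebraMap_iff.mp hcomplete.toIsHausdorff
  have : IsPrecomplete I (WittVector p K) :=
    IsPrecomplete.map_algebraMap_iff.mp hcomplete.toIsPrecomplete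
  let f : WittVector p K →ₗ[ℤ] WittVector p K :=
    (WittVector.frobenius (p := p) (R := K)).toAddMonoidHom.toIntLinearMap - LinearMap.id
  change Function.Surjective f
  refine surjective_of_mkQ_comp_surjective (I := I) (f := f) fun z ↦ ?_
  obtain ⟨y, rfl⟩ := Submodule.mkQ_surjective _ z
  obtain ⟨c, hc⟩ := IsAlgClosed.exists_pow_sub_self_eq (Fact.out : p.Prime).one_lt (y.coeff 0)
  refine ⟨WittVector.teichmuller p c, (Submodule.Quotient.eq _).mpr ?_⟩
  rw [Ideal.smul_top_eq_map, Submodule.restrictScalars_mem, hI,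
    WittVector.mem_span_p_iff_coeff_zero_eq_zero]
  change WittVector.constantCoeff
    (WittVector.frobenius (WittVector.teichmuller p c) - WittVector.teichmuller p c - y) = 0
  rw [map_sub, map_sub]
  simp only [WittVector.constantCoeff_apply, WittVector.coeff_frobenius_charP,
    WittVector.teichmuller_coeff_zero, hc, sub_self]
end

section
/- Let P ∈ ℚ[X,Y] be a polynomial with P(a,b) ∈ ℤ for all integers a, b, and suppose that the 2-cocycle identity P(Y,Z) − P(X+Y,Z) + P(X,Y+Z) − P(X,Y) = 0 holds as an identity in ℚ[X,Y,Z] (where P(X+Y,Z) denotes substitution of X+Y and Z into P, etc.). Then there exists a polynomial Q ∈ ℚ[T] with Q(n) ∈ ℤ for all n ∈ ℤ such that P(X,Y) = Q(X) + Q(Y) − Q(X+Y) in ℚ[X,Y]: every integer-valued polynomial 2-cocycle is a coboundary. -/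
open MvPolynomial

/-- Over `ℚ` every polynomial is the forward difference of a polynomial. -/
theorem Polynomial.exists_forall_eval_add_one_sub_eval (D : Polynomial ℚ) :
    ∃ R : Polynomial ℚ, ∀ x : ℚ, R.eval (x + 1) - R.eval x = D.eval x := by
  induction D using Polynomial.induction_on' with
  | add p q hp hq =>
    obtain ⟨R, hR⟩ := hp
    obtain ⟨S, hS⟩ := hq
    refine ⟨R + S, fun x => ?_⟩
    simp only [Polynomial.eval_add, ← hR, ← hS]
    ring
  | monomial n a =>
    refine ⟨Polynomial.C (a / (n + 1)) * Polynomial.bernoulli (n + 1), fun x => ?_⟩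
    have hn : (n + 1 : ℚ) ≠ 0 := by positivity
    rw [add_comm x 1]
    simp only [Polynomial.eval_mul, Polynomial.eval_C, Polynomial.eval_monomial,
      Polynomial.bernoulli_eval_one_add, Nat.add_sub_cancel, Nat.cast_add, Nat.cast_one]
    field_simp
    ring

/-- Every integer-valued polynomial 2-cocycle is a coboundary: if `P ∈ ℚ[X,Y]` takes
integer values on `ℤ × ℤ` and satisfies the cocycle identity
`P(Y,Z) - P(X+Y,Z) + P(X,Y+Z) - P(X,Y) = 0` in `ℚ[X,Y,Z]`, then there is an
integer-valued polynomial `Q ∈ ℚ[T]` with `P(X,Y) = Q(X) + Q(Y) - Q(X+Y)`.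
This is the degree-2 instance of Corollary 3.3: `H²(S¹,ℤ) = 0` via the cobar complex
of the Hopf algebra of integer-valued polynomials. -/
theorem intValued_two_cocycle_is_coboundary (P : MvPolynomial (Fin 2) ℚ)
    (hint : ∀ a b : ℤ, ∃ m : ℤ, MvPolynomial.eval ![(a : ℚ), (b : ℚ)] P = (m : ℚ))
    (hcocycle :
      aeval ![(X 1 : MvPolynomial (Fin 3) ℚ), X 2] P
        - aeval ![(X 0 : MvPolynomial (Fin 3) ℚ) + X 1, X 2] P
        + aeval ![(X 0 : MvPolynomial (Fin 3) ℚ), X 1 + X 2] P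
        - aeval ![(X 0 : MvPolynomial (Fin 3) ℚ), X 1] P = 0) :
    ∃ Q : Polynomial ℚ, (∀ n : ℤ, ∃ m : ℤ, Q.eval (n : ℚ) = (m : ℚ)) ∧
      P = Polynomial.aeval (X 0 : MvPolynomial (Fin 2) ℚ) Q
        + Polynomial.aeval (X 1 : MvPolynomial (Fin 2) ℚ) Q
        - Polynomial.aeval (X 0 + X 1 : MvPolynomial (Fin 2) ℚ) Q := by
  have eval_cons (x : Fin 3 → ℚ) (p q : MvPolynomial (Fin 3) ℚ) :
      eval x (bind₁ ![p, q] P) = eval ![eval x p, eval x q] P := by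
    rw [← MvPolynomial.coe_aeval_eq_eval, RingHom.coe_coe, MvPolynomial.aeval_bind₁,
      ← MvPolynomial.coe_aeval_eq_eval]
    change aeval _ P = aeval _ P
    congr 2
    ext i
    fin_cases i <;> rfl
  have hP (x y z : ℚ) : eval ![y, z] P - eval ![x + y, z] P + eval ![x, y + z] P
      - eval ![x, y] P = 0 := by
    simpa [eval_cons] using congrArg (eval ![x, y, z]) hcocycle
  have hzero_left : eval ![0, 1] P = eval ![0, 0] P := by
    have h := hP 0 0 1
    simp only [zero_add] at h
    linarith
  have hzero_right (x : ℚ) : eval ![x, 0] P = eval ![0, 0] P := by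
    have h := hP x 0 0
    simp only [add_zero] at h
    linarith
  obtain ⟨R, hR⟩ := Polynomial.exists_forall_eval_add_one_sub_eval
    (-aeval ![(Polynomial.X : Polynomial ℚ), 1] P)
  obtain ⟨Q, hQ, hQ_zero⟩ : ∃ Q : Polynomial ℚ,
      (∀ x, Q.eval (x + 1) = Q.eval x - eval ![x, 1] P) ∧ Q.eval 0 = eval ![0, 0] P := by
    refine ⟨R + Polynomial.C (eval ![0, 0] P - R.eval 0), fun x => ?_, by simp⟩
    have h : (aeval ![(Polynomial.X : Polynomial ℚ), 1] P).eval x = eval ![x, 1] P := by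
      rw [← Polynomial.coe_aeval_eq_eval, ← AlgHom.comp_apply, MvPolynomial.comp_aeval,
        ← MvPolynomial.coe_aeval_eq_eval]
      change _ = aeval _ P
      congr 2
      ext i
      fin_cases i <;> simp
    have hx := hR x
    rw [Polynomial.eval_neg, h] at hx
    simp only [Polynomial.eval_add, Polynomial.eval_C]
    linarith
  have hQ_one : Q.eval 1 = 0 := by
    have h := hQ 0
    rw [zero_add, hQ_zero, hzero_left] at h
    linarith
  have key (x : ℚ) (n : ℕ) :
      eval ![x, (n : ℚ)] P = Q.eval x + Q.eval (n : ℚ) - Q.eval (x + n) := by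
    induction n with
    | zero => simp [hzero_right x, hQ_zero]
    | succ n ih =>
      have h := hP x n 1
      have h₁ := hQ n
      have h₂ := hQ (x + n)
      rw [add_assoc] at h₂
      push_cast
      linarith
  refine ⟨Q, fun n => ?_, ?_⟩
  · induction n using Int.induction_on with
    | zero => simpa [hQ_zero] using hint 0 0
    | succ n ih =>
      obtain ⟨k, hk⟩ := ih
      obtain ⟨m, hm⟩ := hint n 1
      refine ⟨k - m, ?_⟩
      push_cast at *
      rw [hQ, hk, hm]
    | pred n ih =>
      obtain ⟨k, hk⟩ := ih
      obtain ⟨m, hm⟩ := hint (-n - 1) 1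
      refine ⟨k + m, ?_⟩
      have h := hQ (-n - 1)
      push_cast at *
      rw [sub_add_cancel, hk, hm] at h
      linarith
  · refine MvPolynomial.funext_set (fun _ => Set.range ((↑) : ℕ → ℚ))
      (fun _ => Set.infinite_range_of_injective Nat.cast_injective) fun x hx => ?_
    obtain ⟨n, hn⟩ := hx 1 (Set.mem_univ 1)
    have eval_aeval (p : MvPolynomial (Fin 2) ℚ) :
        eval x (Polynomial.aeval p Q) = Q.eval (eval x p) := by
      rw [← MvPolynomial.coe_aeval_eq_eval]
      change aeval x _ = Q.eval (aeval x p)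
      rw [← Polynomial.aeval_algHom_apply, Polynomial.coe_aeval_eq_eval]
    have hx' : x = ![x 0, (n : ℚ)] := by
      ext i
      fin_cases i <;> simp [hn]
    simp only [map_add, map_sub, eval_aeval, eval_X, ← hn, ← key]
    rw [← hx']
end

section
/- Let ℤ̂ = ∏_p ℤ_p denote the product over all primes p of the rings of p-adic integers, and let 𝔸 = ℤ̂ ⊗_ℤ ℚ. Let M be a finitely generated abelian group. Then the sequence of abelian groups 0 → M → (ℚ ⊗_ℤ M) × (ℤ̂ ⊗_ℤ M) → 𝔸 ⊗_ℤ M → 0 is exact, where the first map sends m to (1⊗m, 1⊗m) and the second sends (u, v) to the difference of the images of v and u under the canonical maps ℚ ⊗_ℤ M → 𝔸 ⊗_ℤ M and ℤ̂ ⊗_ℤ M → 𝔸 ⊗_ℤ M. -/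
open TensorProduct

instance (p : Nat.Primes) : Fact (p : ℕ).Prime := ⟨p.2⟩

/-- `ℤ̂ = ∏_p ℤ_p`, the product over all primes of the rings of `p`-adic integers. -/
abbrev Zhat : Type := ∀ p : Nat.Primes, ℤ_[(p : ℕ)]

/-- Divisibility of integers can be tested in the profinite integers. -/
theorem Zhat.dvd_of_intCast_eq_mul {n : ℕ} {k : ℤ} {z : Zhat} (h : (k : Zhat) = n * z) :
    (n : ℤ) ∣ k := by
  rw [Int.natCast_dvd, Nat.dvd_iff_prime_pow_dvd_dvd]
  intro p j hp hj
  have : Fact p.Prime := ⟨hp⟩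
  have hk : (k : ℤ_[p]) = n * z ⟨p, hp⟩ := congrFun h ⟨p, hp⟩
  rw [← Int.natCast_dvd, Nat.cast_pow, ← PadicInt.norm_int_le_pow_iff_dvd,
    PadicInt.norm_le_pow_iff_mem_span_pow, Ideal.mem_span_singleton, hk]
  exact Dvd.dvd.mul_right (by exact_mod_cast Nat.cast_dvd_cast (α := ℤ_[p]) hj) _

/-- The integers surject onto the quotient of the profinite integers by a nonzero integer. -/
theorem Zhat.exists_eq_intCast_add_mul {n : ℕ} (hn : n ≠ 0) (z : Zhat) :
    ∃ (k : ℤ) (w : Zhat), z = k + n * w := by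
  let t : Finset Nat.Primes := n.primeFactors.subtype Nat.Prime
  obtain ⟨k, hk⟩ := Nat.chineseRemainderOfFinset
    (fun p : Nat.Primes => (z p).appr (n.factorization p))
    (fun p : Nat.Primes => (p : ℕ) ^ n.factorization p) t
    (fun p _ => pow_ne_zero _ p.2.ne_zero)
    (fun p _ q _ hpq => Nat.Coprime.pow _ _
      ((Nat.coprime_primes p.2 q.2).2 fun h => hpq (Subtype.ext h)))
  have key (p : Nat.Primes) : (n : ℤ_[(p : ℕ)]) ∣ z p - k := by
    have hunit : IsUnit ((n / (p : ℕ) ^ n.factorization p : ℕ) : ℤ_[(p : ℕ)]) := by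
      rw [PadicInt.isUnit_iff, PadicInt.norm_natCast_eq_one_iff]
      exact Nat.coprime_ordCompl p.2 hn
    rw [← Nat.ordProj_mul_ordCompl_eq_self n p, Nat.cast_mul, hunit.mul_right_dvd, Nat.cast_pow]
    by_cases hp : (p : ℕ) ∣ n
    · have h₁ := Ideal.mem_span_singleton.1 (PadicInt.appr_spec (n.factorization p) (z p))
      have h₂ := Nat.modEq_iff_dvd.1
        (hk p (Finset.mem_subtype.2 (Nat.mem_primeFactors.2 ⟨p.2, hp, hn⟩)))
      have h₃ := map_dvd (Int.castRingHom ℤ_[(p : ℕ)]) h₂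
      push_cast [eq_intCast] at h₃
      simpa using dvd_add h₁ h₃
    · simp [Nat.factorization_eq_zero_of_not_dvd hp]
  choose w hw using key
  refine ⟨k, w, funext fun p => ?_⟩
  simpa [sub_eq_iff_eq_add'] using hw p

section Fracture

variable {S A B C : Type} [CommRing S] [AddCommGroup A] [Module S A] [AddCommGroup B] [Module S B]
  [AddCommGroup C] [Module S C]

/-- The difference map `(u, v) ↦ i v - j u` of a cospan of modules. -/
def differenceMap (i : B →ₗ[S] C) (j : A →ₗ[S] C) : A × B →ₗ[S] C :=
  i ∘ₗ LinearMap.snd S A B - j ∘ₗ LinearMap.fst S A B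

theorem differenceMap_apply (i : B →ₗ[S] C) (j : A →ₗ[S] C) (y : A × B) :
    differenceMap i j y = i y.2 - j y.1 := rfl

variable {M : Type} [AddCommGroup M] [Module S M]

/-- The tensored difference map, in terms of the distributivity of `⊗` over `×`. -/
theorem rTensor_differenceMap_apply (i : B →ₗ[S] C) (j : A →ₗ[S] C) (x : (A × B) ⊗[S] M) :
    (differenceMap i j).rTensor M x =
      i.rTensor M (TensorProduct.prodLeft S S A B M x).2 -
        j.rTensor M (TensorProduct.prodLeft S S A B M x).1 := by
  induction x with
  | zero => simp
  | tmul y m =>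
    obtain ⟨u, v⟩ := y
    simp [differenceMap_apply, TensorProduct.sub_tmul]
  | add x y hx hy =>
    simp only [map_add, hx, hy, Prod.fst_add, Prod.snd_add]
    abel

theorem prodLeft_rTensor_toSpanSingleton (a : A) (b : B) (m : M) :
    TensorProduct.prodLeft S S A B M
      ((LinearMap.toSpanSingleton S (A × B) (a, b)).rTensor M ((1 : S) ⊗ₜ m)) =
      (a ⊗ₜ m, b ⊗ₜ m) := by
  simp

theorem Module.Flat.tensorProduct (A B : Type) [AddCommGroup A] [Module S A] [AddCommGroup B]
    [Module S B] [Module.Flat S A] [Module.Flat S B] : Module.Flat S (A ⊗[S] B) :=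
  inferInstance

/-- A short exact sequence `0 → S → A × B → C → 0` with `C` flat stays exact after tensoring
with any module. -/
theorem fracture_exact_tensor [Module.Flat S C] (i : B →ₗ[S] C) (j : A →ₗ[S] C) (a : A) (b : B)
    (hinj : Function.Injective (LinearMap.toSpanSingleton S (A × B) (a, b)))
    (hexact : Function.Exact (LinearMap.toSpanSingleton S (A × B) (a, b)) (differenceMap i j))
    (hsurj : Function.Surjective (differenceMap i j)) :
    Function.Injective (fun m : M => ((a ⊗ₜ[S] m : A ⊗[S] M), (b ⊗ₜ[S] m : B ⊗[S] M))) ∧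
    (∀ y : (A ⊗[S] M) × (B ⊗[S] M), i.rTensor M y.2 - j.rTensor M y.1 = 0 ↔
      ∃ m : M, ((a ⊗ₜ[S] m : A ⊗[S] M), (b ⊗ₜ[S] m : B ⊗[S] M)) = y) ∧
    Function.Surjective
      (fun y : (A ⊗[S] M) × (B ⊗[S] M) => i.rTensor M y.2 - j.rTensor M y.1) := by
  have hexactM := rTensor_exact M hexact hsurj
  have hinjM := LinearMap.lTensor_injective_of_exact_of_flat _ hsurj _ hinj hexact M
  rw [LinearMap.lTensor_inj_iff_rTensor_inj] at hinjM
  refine ⟨fun m m' h => ?_, fun y => ?_, fun c => ?_⟩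
  · apply (TensorProduct.lid S M).symm.injective
    apply hinjM
    apply (TensorProduct.prodLeft S S A B M).injective
    simpa only [TensorProduct.lid_symm_apply, prodLeft_rTensor_toSpanSingleton] using h
  · obtain ⟨x, rfl⟩ := (TensorProduct.prodLeft S S A B M).surjective y
    rw [← rTensor_differenceMap_apply, hexactM x]
    simp only [← prodLeft_rTensor_toSpanSingleton, EmbeddingLike.apply_eq_iff_eq]
    exact (TensorProduct.lid S M).symm.surjective.exists
  · obtain ⟨x, rfl⟩ := LinearMap.rTensor_surjective M hsurj c
    exact ⟨_, (rTensor_differenceMap_apply i j x).symm⟩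

end Fracture

section IntegralModel

variable {R : Type} [CommRing R]

theorem exists_int_of_tmul_one_eq_one_tmul [Module.IsTorsionFree ℤ R]
    (hdvd : ∀ (n : ℕ) (k : ℤ) (z : R), (k : R) = n * z → (n : ℤ) ∣ k) {q : ℚ} {z : R}
    (h : z ⊗ₜ[ℤ] (1 : ℚ) = (1 : R) ⊗ₜ[ℤ] q) : ∃ k : ℤ, (k : ℚ) = q ∧ (k : R) = z := by
  have hd : (q.den : ℤ) ≠ 0 := by exact_mod_cast q.den_nz
  have hq : (q.den : ℤ) • q = q.num • (1 : ℚ) := by simp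
  have hz : (q.den : ℤ) • z = q.num • (1 : R) := by
    apply Algebra.TensorProduct.includeLeft_injective (S := ℤ) (B := ℚ)
      (algebraMap ℤ ℚ).injective_int
    simp only [Algebra.TensorProduct.includeLeft_apply]
    rw [← TensorProduct.smul_tmul', h, ← TensorProduct.tmul_smul, hq, TensorProduct.smul_tmul]
  obtain ⟨k, hk⟩ := hdvd q.den q.num z (by simpa using hz.symm)
  refine ⟨k, smul_right_injective ℚ hd ?_, smul_right_injective R hd ?_⟩
  · simp [hk]
  · simp only [hz]
    simp [hk]

theorem exists_tmul_one_sub_one_tmul_eq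
    (hdecomp : ∀ n : ℕ, n ≠ 0 → ∀ z : R, ∃ (k : ℤ) (w : R), z = k + n * w) (c : R ⊗[ℤ] ℚ) :
    ∃ (q : ℚ) (z : R), z ⊗ₜ[ℤ] (1 : ℚ) - (1 : R) ⊗ₜ[ℤ] q = c := by
  induction c with
  | zero => exact ⟨0, 0, by simp⟩
  | tmul z q =>
    obtain ⟨k, w, rfl⟩ := hdecomp q.den q.den_nz z
    refine ⟨-(k • q), q.num • w, ?_⟩
    have h₁ : (k : R) = k • (1 : R) := by simp
    have h₂ : (q.den : R) * w = (q.den : ℤ) • w := by simp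
    have h₃ : (q.den : ℤ) • q = q.num • (1 : ℚ) := by simp
    rw [TensorProduct.add_tmul, h₁, h₂, TensorProduct.smul_tmul,
      TensorProduct.smul_tmul, TensorProduct.smul_tmul, h₃, TensorProduct.tmul_neg]
    abel
  | add c c' h h' =>
    obtain ⟨q, z, rfl⟩ := h
    obtain ⟨q', z', rfl⟩ := h'
    refine ⟨q + q', z + z', ?_⟩
    rw [TensorProduct.add_tmul, TensorProduct.tmul_add]
    abel

end IntegralModel

/-- The fracture exact sequence for a finitely generated abelian group `M`:
`0 → M → (ℚ ⊗ M) × (ℤ̂ ⊗ M) → 𝔸 ⊗ M → 0` is exact, where `𝔸 = ℤ̂ ⊗_ℤ ℚ`,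
the first map is `m ↦ (1 ⊗ m, 1 ⊗ m)` and the second sends `(u, v)` to the difference
of the images of `v` and `u` under the canonical maps to `𝔸 ⊗ M`. -/
theorem fracture_exact_of_fg (M : Type) [AddCommGroup M] [AddGroup.FG M] :
    Function.Injective
      (fun m : M => (((1 : ℚ) ⊗ₜ[ℤ] m : ℚ ⊗[ℤ] M), ((1 : Zhat) ⊗ₜ[ℤ] m : Zhat ⊗[ℤ] M))) ∧
    (∀ y : (ℚ ⊗[ℤ] M) × (Zhat ⊗[ℤ] M),
      (LinearMap.rTensor M
          (Algebra.TensorProduct.includeLeft (R := ℤ) (S := ℤ) (A := Zhat) (B := ℚ)).toLinearMap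
        y.2 -
       LinearMap.rTensor M
          (Algebra.TensorProduct.includeRight (R := ℤ) (A := Zhat) (B := ℚ)).toLinearMap
        y.1 : (Zhat ⊗[ℤ] ℚ) ⊗[ℤ] M) = 0 ↔
        ∃ m : M, (((1 : ℚ) ⊗ₜ[ℤ] m : ℚ ⊗[ℤ] M), ((1 : Zhat) ⊗ₜ[ℤ] m : Zhat ⊗[ℤ] M)) = y) ∧
    Function.Surjective
      (fun y : (ℚ ⊗[ℤ] M) × (Zhat ⊗[ℤ] M) =>
        (LinearMap.rTensor M
            (Algebra.TensorProduct.includeLeft (R := ℤ) (S := ℤ) (A := Zhat) (B := ℚ)).toLinearMap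
          y.2 -
         LinearMap.rTensor M
            (Algebra.TensorProduct.includeRight (R := ℤ) (A := Zhat) (B := ℚ)).toLinearMap
          y.1 : (Zhat ⊗[ℤ] ℚ) ⊗[ℤ] M)) := by
  have : Module.Flat ℤ (Zhat ⊗[ℤ] ℚ) := Module.Flat.tensorProduct Zhat ℚ
  refine fracture_exact_tensor _ _ 1 1 (fun k l h => ?_) (fun y => ⟨fun h => ?_, ?_⟩) fun c => ?_
  · simpa using congrArg Prod.fst h
  · obtain ⟨k, hq, hz⟩ := exists_int_of_tmul_one_eq_one_tmul
      (fun _ _ _ => Zhat.dvd_of_intCast_eq_mul) (sub_eq_zero.1 h)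
    exact ⟨k, Prod.ext (by simpa using hq) (by simpa using hz)⟩
  · rintro ⟨k, rfl⟩
    rw [LinearMap.toSpanSingleton_apply, Prod.smul_mk]
    exact sub_eq_zero.2 (TensorProduct.smul_tmul (R := ℤ) k (1 : Zhat) (1 : ℚ))
  · obtain ⟨q, z, h⟩ := exists_tmul_one_sub_one_tmul_eq
      (fun _ => Zhat.exists_eq_intCast_add_mul) c
    exact ⟨(q, z), h⟩
end

section
/- Let R be a commutative ring and let (A_i)_{i ∈ I} be a directed system of commutative R-algebras indexed by a directed preorder I, with transition maps that are R-algebra homomorphisms. If each A_i is faithfully flat as an R-module, then the direct limit colim_i A_i is faithfully flat as an R-module. -/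
open TensorProduct

section

variable {R : Type*} [CommRing R] {I : Type*} [Preorder I] [IsDirected I (· ≤ ·)]
  [DecidableEq I] {G : I → Type*} [∀ i, AddCommGroup (G i)] [∀ i, Module R (G i)]
  {g : ∀ i j, i ≤ j → G i →ₗ[R] G j}

/-- Every element of `(colim G) ⊗ M` comes from some `Gᵢ ⊗ M`. -/
theorem Module.DirectLimit.exists_rTensor_of [Nonempty I] {M : Type*} [AddCommGroup M]
    [Module R M] (x : Module.DirectLimit G g ⊗[R] M) :
    ∃ i, ∃ y : G i ⊗[R] M, (Module.DirectLimit.of R I G g i).rTensor M y = x := by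
  obtain ⟨i, y, hy⟩ := Module.DirectLimit.exists_of (TensorProduct.directLimitLeft g M x)
  refine ⟨i, y, (TensorProduct.directLimitLeft g M).injective ?_⟩
  rw [TensorProduct.directLimitLeft_rTensor_of, hy]

variable [DirectedSystem G (fun i j h => g i j h)]

/-- An element of `Gᵢ ⊗ M` that vanishes in `(colim G) ⊗ M` already vanishes at a finite stage. -/
theorem Module.DirectLimit.exists_rTensor_eq_zero {M : Type*} [AddCommGroup M] [Module R M]
    {i : I} {y : G i ⊗[R] M} (hy : (Module.DirectLimit.of R I G g i).rTensor M y = 0) :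
    ∃ j, ∃ h : i ≤ j, (g i j h).rTensor M y = 0 := by
  have h := TensorProduct.directLimitLeft_rTensor_of g M y
  rw [hy, map_zero] at h
  exact Module.DirectLimit.of.zero_exact h.symm

/-- A directed colimit of flat modules is flat. -/
theorem Module.Flat.directLimit [Nonempty I] [∀ i, Module.Flat R (G i)] :
    Module.Flat R (Module.DirectLimit G g) := by
  rw [Module.Flat.iff_lTensor_preserves_injective_linearMap]
  intro N P _ _ _ _ u hu
  rw [injective_iff_map_eq_zero]
  intro x hx
  obtain ⟨i, y, rfl⟩ := Module.DirectLimit.exists_rTensor_of x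
  rw [← LinearMap.comp_apply, LinearMap.lTensor_comp_rTensor, ← LinearMap.rTensor_comp_lTensor,
    LinearMap.comp_apply] at hx
  obtain ⟨j, hij, hj⟩ := Module.DirectLimit.exists_rTensor_eq_zero hx
  rw [← LinearMap.comp_apply, LinearMap.rTensor_comp_lTensor, ← LinearMap.lTensor_comp_rTensor,
    LinearMap.comp_apply] at hj
  have hy : (g i j hij).rTensor N y = 0 :=
    (injective_iff_map_eq_zero _).1
      (Module.Flat.lTensor_preserves_injective_linearMap (M := G j) u hu) _ hj
  have hcomp : Module.DirectLimit.of R I G g i =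
      Module.DirectLimit.of R I G g j ∘ₗ g i j hij := by
    ext z
    exact Module.DirectLimit.of_f.symm
  rw [hcomp, LinearMap.rTensor_comp_apply, hy, map_zero]

end

/-- A directed colimit of faithfully flat `R`-algebras (a directed system of commutative
`R`-algebras with `R`-algebra homomorphisms as transition maps, each faithfully flat as an
`R`-module) is faithfully flat as an `R`-module. -/
theorem directLimit_faithfullyFlat
    (R : Type) [CommRing R]
    (I : Type) [Preorder I] [IsDirected I (· ≤ ·)] [Nonempty I] [DecidableEq I]
    (A : I → Type) [∀ i, CommRing (A i)] [∀ i, Algebra R (A i)]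
    (f : ∀ i j, i ≤ j → A i →ₐ[R] A j)
    [DirectedSystem A (fun i j h => (f i j h : A i → A j))]
    (hff : ∀ i, Module.FaithfullyFlat R (A i)) :
    Module.FaithfullyFlat R
      (Module.DirectLimit A (fun i j h => (f i j h).toLinearMap)) := by
  have : DirectedSystem A (fun i j h => (f i j h).toLinearMap) :=
    inferInstanceAs (DirectedSystem A (fun i j h => f i j h))
  rw [Module.FaithfullyFlat.iff_flat_and_lTensor_reflects_triviality]
  refine ⟨Module.Flat.directLimit, fun N _ _ hN => subsingleton_of_forall_eq 0 fun n => ?_⟩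
  obtain ⟨i⟩ := ‹Nonempty I›
  obtain ⟨j, hij, hj⟩ := Module.DirectLimit.exists_rTensor_eq_zero
    (g := fun i j h => (f i j h).toLinearMap) (i := i) (y := (1 : A i) ⊗ₜ[R] n)
    (Subsingleton.elim _ _)
  rw [LinearMap.rTensor_tmul, AlgHom.toLinearMap_apply, map_one] at hj
  exact (Module.FaithfullyFlat.one_tmul_eq_zero_iff R N n).1 hj
end
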